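/- arXiv:2509.17604 — 2 statements merged into one kernel-verified Lean document; each statement's English description precedes it below -/
import Mathlib

section
/- Let k be a field of characteristic p > 0 and let m ≥ 0. The cohomological Mackey algebra μ^coh_k(C_{p^m}) of the cyclic group of order p^m has finite representation type if and only if m ≤ 1. -/
universe u

open CategoryTheory CategoryTheory.Limits TensorProduct

/-- An object of an additive category is *indecomposable* if it is nonzero and, whenever
it is isomorphic to the vertex of a binary biproduct diagram, one of the two summands is
zero. -/
def IsIndecomposable {C : Type*} [Category C] [HasZeroMorphisms C] (X : C) : Prop :=
  ¬ IsZero X ∧ ∀ (A B : C) (c : BinaryBicone A B), Nonempty c.IsBilimit →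
    Nonempty (X ≅ c.pt) → IsZero A ∨ IsZero B

/-- The direct sum `⊕_{H ≤ G} k[G/H]` of all transitive permutation representations of
`G` over `k`, realized as the permutation representation on `Σ H : Subgroup G, G ⧸ H`. -/
noncomputable def allPermRep (k G : Type u) [CommRing k] [Group G] : Rep k G :=
  Rep.ofMulAction k G (Σ H : Subgroup G, G ⧸ H)

/-- The cohomological Mackey algebra `μ^{coh}_k(G)`: the opposite algebra of the
endomorphism algebra of the direct sum of all transitive permutation modules `k[G/H]`
over the group algebra `kG`. -/
noncomputable def CohMackey (k G : Type u) [CommRing k] [Group G] : Type u :=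
  (CategoryTheory.End (allPermRep k G))ᵐᵒᵖ

noncomputable instance (k G : Type u) [CommRing k] [Group G] : Ring (CohMackey k G) :=
  inferInstanceAs (Ring (CategoryTheory.End (allPermRep k G))ᵐᵒᵖ)

noncomputable instance (k G : Type u) [CommRing k] [Group G] : Algebra k (CohMackey k G) :=
  inferInstanceAs (Algebra k (CategoryTheory.End (allPermRep k G))ᵐᵒᵖ)

/-- A `k`-algebra `Λ` has *finite representation type* if there are, up to isomorphism,
only finitely many finite dimensional indecomposable `Λ`-modules. -/
def HasFiniteRepType (k : Type u) [Field k] (Λ : Type u) [Ring Λ] [Algebra k Λ] : Prop :=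
  ∃ (n : ℕ) (V : Fin n → ModuleCat.{u} Λ),
    ∀ (M : Type u) [AddCommGroup M] [Module k M] [Module Λ M] [IsScalarTower k Λ M],
      FiniteDimensional k M → IsIndecomposable (ModuleCat.of Λ M) →
        ∃ i, Nonempty (M ≃ₗ[Λ] (V i))

namespace CohMackey

section MatrixModel

variable {k G : Type u} [Field k] [Group G]

/-- The `G`-equivariant linear map underlying an element of the cohomological Mackey algebra. -/
noncomputable def toIntertwiningMap (a : CohMackey k G) :
    (Representation.ofMulAction k G (Σ H : Subgroup G, G ⧸ H)).IntertwiningMap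
      (Representation.ofMulAction k G (Σ H : Subgroup G, G ⧸ H)) :=
  (MulOpposite.unop a : End (allPermRep k G)).asHom.hom

/-- The matrix of an element of the cohomological Mackey algebra in the permutation basis; the
row indexed by `x` holds the coefficients of the image of `x`. -/
noncomputable def toMatrix :
    CohMackey k G →ₗ[k] Matrix (Σ H : Subgroup G, G ⧸ H) (Σ H : Subgroup G, G ⧸ H) k where
  toFun a x y := (a.toIntertwiningMap (MonoidAlgebra.single x 1)).coeff y
  map_add' a b := by
    ext x y
    rfl
  map_smul' c a := by
    ext x y
    rfl

theorem toMatrix_apply (a : CohMackey k G) (x y : Σ H : Subgroup G, G ⧸ H) :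
    toMatrix a x y = (a.toIntertwiningMap (MonoidAlgebra.single x 1)).coeff y :=
  rfl

theorem toMatrix_smul_smul (a : CohMackey k G) (g : G) (x y : Σ H : Subgroup G, G ⧸ H) :
    toMatrix a (g • x) (g • y) = toMatrix a x y := by
  rw [toMatrix_apply, ← Representation.ofMulAction_single (k := k),
    a.toIntertwiningMap.isIntertwining, Representation.coeff_ofMulAction, inv_smul_smul]
  rfl

theorem toMatrix_injective : Function.Injective (toMatrix (k := k) (G := G)) := by
  intro a b h
  have h' : a.toIntertwiningMap = b.toIntertwiningMap := by
    refine Representation.IntertwiningMap.ext ?_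
    refine MonoidAlgebra.lhom_ext' fun x => LinearMap.ext_ring ?_
    ext y
    exact congrFun (congrFun h x) y
  exact MulOpposite.unop_injective (Rep.hom_ext h')

theorem exists_toMatrix_eq [Finite G]
    (F : Matrix (Σ H : Subgroup G, G ⧸ H) (Σ H : Subgroup G, G ⧸ H) k)
    (hF : ∀ (g : G) x y, F (g • x) (g • y) = F x y) :
    ∃ a : CohMackey k G, toMatrix a = F := by
  have := Fintype.ofFinite (Σ H : Subgroup G, G ⧸ H)
  let L : MonoidAlgebra k (Σ H : Subgroup G, G ⧸ H) →ₗ[k] 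
      MonoidAlgebra k (Σ H : Subgroup G, G ⧸ H) :=
    (MonoidAlgebra.basis (Σ H : Subgroup G, G ⧸ H) k).constr k fun x =>
      (MonoidAlgebra.coeffLinearEquiv k).symm (Finsupp.equivFunOnFinite.symm (F x))
  have hL (x y) : (L (MonoidAlgebra.single x 1)).coeff y = F x y := by
    have : L (MonoidAlgebra.single x 1) = _ :=
      (MonoidAlgebra.basis (Σ H : Subgroup G, G ⧸ H) k).constr_basis k _ x
    rw [this]
    rfl
  have hL' : ∀ g v, L (Representation.ofMulAction k G _ g v) =
      Representation.ofMulAction k G _ g (L v) := by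
    intro g v
    rw [← LinearMap.comp_apply, ← LinearMap.comp_apply]
    congr 1
    refine MonoidAlgebra.lhom_ext' fun x => LinearMap.ext_ring ?_
    ext y
    change (L (Representation.ofMulAction k G _ g (MonoidAlgebra.single x 1))).coeff y =
      (Representation.ofMulAction k G _ g (L (MonoidAlgebra.single x 1))).coeff y
    rw [Representation.coeff_ofMulAction, Representation.ofMulAction_single, hL, hL,
      ← hF g x, smul_inv_smul]
  refine ⟨MulOpposite.op (End.of (X := allPermRep k G)
    (Rep.ofHom (L.intertwiningMap_of_isIntertwiningMap _ _ hL'))), ?_⟩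
  ext x y
  exact hL x y

theorem toMatrix_one [DecidableEq (Σ H : Subgroup G, G ⧸ H)] :
    toMatrix (1 : CohMackey k G) = 1 := by
  ext x y
  change (MonoidAlgebra.single x 1 : MonoidAlgebra k _).coeff y = _
  simp [Matrix.one_apply, Finsupp.single_apply]

theorem toMatrix_mul [Fintype (Σ H : Subgroup G, G ⧸ H)] (a b : CohMackey k G) :
    toMatrix (a * b) = toMatrix a * toMatrix b := by
  ext x z
  rw [toMatrix_apply, Matrix.mul_apply]
  have h : (a * b).toIntertwiningMap (MonoidAlgebra.single x 1) =
    b.toIntertwiningMap (a.toIntertwiningMap (MonoidAlgebra.single x 1)) := rfl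
  rw [h]
  have key (v : MonoidAlgebra k (Σ H : Subgroup G, G ⧸ H)) :
      (b.toIntertwiningMap v).coeff z = ∑ y, v.coeff y * toMatrix b y z := by
    have hv : v = ∑ y, v.coeff y • MonoidAlgebra.single y (1 : k) := by
      conv_lhs => rw [← (MonoidAlgebra.basis (Σ H : Subgroup G, G ⧸ H) k).sum_repr v]
      rfl
    conv_lhs => rw [hv]
    rw [map_sum]
    simp only [map_smul, toMatrix_apply]
    change (MonoidAlgebra.coeffLinearEquiv k _) z = _
    rw [map_sum, Finsupp.finsetSum_apply]
    rfl
  rw [key]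
  rfl

instance finiteDimensional [Finite G] : FiniteDimensional k (CohMackey k G) := by
  have := Fintype.ofFinite (Σ H : Subgroup G, G ⧸ H)
  exact FiniteDimensional.of_injective toMatrix toMatrix_injective

end MatrixModel

end CohMackey

section Indecomposable

variable {A : Type u} [Ring A] {M : Type u} [AddCommGroup M] [Module A M]

theorem isIndecomposable_of_forall_idempotent [Nontrivial M]
    (h : ∀ π : M →ₗ[A] M, π ∘ₗ π = π → π = 0 ∨ π = LinearMap.id) :
    IsIndecomposable (ModuleCat.of A M) := by
  refine ⟨fun h0 => ?_, ?_⟩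
  · rw [ModuleCat.isZero_iff_subsingleton] at h0
    exact not_subsingleton M h0
  · rintro X Y c - ⟨i⟩
    let π : ModuleCat.of A M ⟶ ModuleCat.of A M := i.hom ≫ (c.fst ≫ c.inl) ≫ i.inv
    have hπ : π ≫ π = π := by simp [π]
    have hc : c.fst ≫ c.inl = i.inv ≫ π ≫ i.hom := by simp [π]
    rcases h π.hom (congrArg ModuleCat.Hom.hom hπ) with h0 | h1
    · left
      have h0' : π = 0 := ModuleCat.hom_ext h0
      rw [IsZero.iff_id_eq_zero]
      have : c.inl ≫ (c.fst ≫ c.inl) ≫ c.fst = 𝟙 X := by simp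
      rw [← this, hc, h0']
      simp
    · right
      have h1' : π = 𝟙 _ := ModuleCat.hom_ext h1
      rw [IsZero.iff_id_eq_zero]
      have : c.inr ≫ (c.fst ≫ c.inl) ≫ c.snd = 0 := by simp
      rw [← this, hc, h1']
      simp

theorem IsIndecomposable.eq_bot_or_eq_bot_of_isCompl (h : IsIndecomposable (ModuleCat.of A M))
    {P Q : Submodule A M} (hPQ : IsCompl P Q) : P = ⊥ ∨ Q = ⊥ := by
  let c : BinaryBicone (ModuleCat.of A P) (ModuleCat.of A Q) :=
    { pt := ModuleCat.of A M
      fst := ModuleCat.ofHom (P.projectionOnto Q hPQ)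
      snd := ModuleCat.ofHom (Q.projectionOnto P hPQ.symm)
      inl := ModuleCat.ofHom P.subtype
      inr := ModuleCat.ofHom Q.subtype
      inl_fst := by ext x; simp
      inl_snd := by ext x; simp
      inr_fst := by ext x; simp
      inr_snd := by ext x; simp }
  have hc : c.IsBilimit := isBinaryBilimitOfTotal c (by
    ext x
    exact Submodule.projection_add_projection_eq_self hPQ x)
  have := h.2 _ _ c ⟨hc⟩ ⟨Iso.refl _⟩
  simpa only [ModuleCat.isZero_iff_subsingleton, ModuleCat.of_coe,
    Submodule.subsingleton_iff_eq_bot] using this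

theorem IsIndecomposable.nontrivial (h : IsIndecomposable (ModuleCat.of A M)) : Nontrivial M := by
  by_contra h'
  rw [not_nontrivial_iff_subsingleton] at h'
  exact h.1 (ModuleCat.isZero_of_subsingleton _)

end Indecomposable

section Coinduction

variable {k A M M' : Type u} [Field k] [Ring A] [Algebra k A]
  [AddCommGroup M'] [Module k M'] [AddCommGroup M] [Module k M]

/-- The coinduced module of a representation of the corner `e A e`. The representation on `M` is
given by `ρ : A → End M` with `ρ (a * e * b) = ρ a * ρ b`, i.e. `ρ a` is the action of `e a e`. -/
def CornerCoind (e : A) (ρ : A →ₗ[k] Module.End k M) : Submodule k (A →ₗ[k] M) where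
  carrier := {φ | ∀ a b, φ (a * e * b) = ρ a (φ b)}
  add_mem' hφ hψ a b := by simp [hφ a b, hψ a b]
  zero_mem' a b := by simp
  smul_mem' c φ hφ a b := by simp [hφ a b]

namespace CornerCoind

variable {e : A} {ρ : A →ₗ[k] Module.End k M} {ρ' : A →ₗ[k] Module.End k M'}

instance : SMul A (CornerCoind e ρ) :=
  ⟨fun s φ => ⟨φ.1 ∘ₗ LinearMap.mulRight k s, fun a b => by
    simpa [mul_assoc] using φ.2 a (b * s)⟩⟩

theorem smul_apply (s : A) (φ : CornerCoind e ρ) (b : A) : (s • φ).1 b = φ.1 (b * s) := rfl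

theorem ext {φ ψ : CornerCoind e ρ} (h : ∀ b, φ.1 b = ψ.1 b) : φ = ψ :=
  Subtype.ext (LinearMap.ext h)

instance : Module A (CornerCoind e ρ) where
  one_smul φ := ext fun b => by simp [smul_apply]
  mul_smul s t φ := ext fun b => by simp [smul_apply, mul_assoc]
  smul_zero s := ext fun b => by simp [smul_apply]
  smul_add s φ ψ := ext fun b => by simp [smul_apply]
  add_smul s t φ := ext fun b => by simp [smul_apply, mul_add]
  zero_smul φ := ext fun b => by simp [smul_apply]

instance : IsScalarTower k A (CornerCoind e ρ) where
  smul_assoc c s φ := ext fun b => by simp [smul_apply]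

/-- The embedding of a representation of the corner `e A e` in its coinduced module. -/
def incl (hmul : ∀ a b, ρ (a * e * b) = ρ a * ρ b) : M →ₗ[k] CornerCoind e ρ where
  toFun m := ⟨ρ.flip m, fun a b => by simp [hmul]⟩
  map_add' m m' := ext fun b => by simp
  map_smul' c m := ext fun b => by simp

theorem incl_apply (hmul : ∀ a b, ρ (a * e * b) = ρ a * ρ b) (m : M) (b : A) :
    (incl hmul m).1 b = ρ b m := rfl

theorem smul_eq_incl (hmul : ∀ a b, ρ (a * e * b) = ρ a * ρ b) (φ : CornerCoind e ρ) :
    e • φ = incl hmul (φ.1 1) :=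
  ext fun b => by simpa [smul_apply, incl_apply] using φ.2 b 1

theorem smul_smul_incl (hmul : ∀ a b, ρ (a * e * b) = ρ a * ρ b) (a : A) (m : M) :
    e • a • incl hmul m = incl hmul (ρ a m) := by
  rw [smul_eq_incl hmul, smul_apply, incl_apply, one_mul]

theorem incl_apply_one (hmul : ∀ a b, ρ (a * e * b) = ρ a * ρ b) (hone : ρ 1 = 1) (m : M) :
    (incl hmul m).1 1 = m := by simp [incl_apply, hone]

theorem incl_injective (hmul : ∀ a b, ρ (a * e * b) = ρ a * ρ b) (hone : ρ 1 = 1) :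
    Function.Injective (incl hmul) := fun m m' h => by
  rw [← incl_apply_one hmul hone m, h, incl_apply_one hmul hone]

theorem smul_incl (hmul : ∀ a b, ρ (a * e * b) = ρ a * ρ b) (hone : ρ 1 = 1) (m : M) :
    e • incl hmul m = incl hmul m := by
  rw [smul_eq_incl hmul, incl_apply_one hmul hone]

theorem isIndecomposable [Nontrivial M] (hmul : ∀ a b, ρ (a * e * b) = ρ a * ρ b)
    (hone : ρ 1 = 1)
    (hind : ∀ π : Module.End k M, π * π = π → (∀ a, π * ρ a = ρ a * π) → π = 0 ∨ π = 1) :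
    IsIndecomposable (ModuleCat.of A (CornerCoind e ρ)) := by
  have := (incl_injective hmul hone).nontrivial
  apply isIndecomposable_of_forall_idempotent
  -- an endomorphism of the coinduced module is determined by its restriction to the corner
  have restrict (π : CornerCoind e ρ →ₗ[A] CornerCoind e ρ) :
      ∃ σ : Module.End k M, ∀ m, incl hmul (σ m) = π (incl hmul m) := by
    refine ⟨(LinearMap.applyₗ (1 : A)) ∘ₗ (CornerCoind e ρ).subtype ∘ₗ
      (π.restrictScalars k) ∘ₗ incl hmul, fun m => ?_⟩
    rw [← smul_incl hmul hone m, map_smul, smul_eq_incl hmul, ← smul_incl hmul hone m]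
    simp [smul_incl hmul hone]
  have eq_zero (π : CornerCoind e ρ →ₗ[A] CornerCoind e ρ)
      (hπ : ∀ m, π (incl hmul m) = 0) : π = 0 := by
    ext φ : 1
    refine ext fun b => incl_injective hmul hone ?_
    have : (π φ).1 b = (b • π φ).1 1 := by rw [smul_apply, one_mul]
    rw [this, ← smul_eq_incl hmul, ← map_smul, ← map_smul, smul_eq_incl hmul, hπ]
    simp
  intro π hπ
  obtain ⟨σ, hσ⟩ := restrict π
  have hinj := incl_injective hmul hone
  have hidem : σ * σ = σ := by
    ext m
    apply hinj
    rw [Module.End.mul_apply, hσ, hσ, ← LinearMap.comp_apply, hπ]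
  have hcomm (a : A) : σ * ρ a = ρ a * σ := by
    ext m
    apply hinj
    rw [Module.End.mul_apply, Module.End.mul_apply, hσ, ← smul_smul_incl, ← smul_smul_incl,
      map_smul, map_smul, hσ]
  rcases hind σ hidem hcomm with rfl | rfl
  · left
    exact eq_zero π fun m => by simp [← hσ]
  · right
    refine (sub_eq_zero.mp (eq_zero (LinearMap.id - π) fun m => ?_)).symm
    simp [← hσ]

theorem finrank_le_of_linearEquiv [FiniteDimensional k M']
    (hmul : ∀ a b, ρ (a * e * b) = ρ a * ρ b) (hone : ρ 1 = 1)
    (hmul' : ∀ a b, ρ' (a * e * b) = ρ' a * ρ' b)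
    (f : CornerCoind e ρ ≃ₗ[A] CornerCoind e ρ') :
    Module.finrank k M ≤ Module.finrank k M' := by
  let g : M →ₗ[k] M' := (LinearMap.applyₗ (1 : A)) ∘ₗ (CornerCoind e ρ').subtype ∘ₗ
      (f.toLinearMap.restrictScalars k) ∘ₗ incl hmul
  have hg (m) : incl hmul' (g m) = f (incl hmul m) := by
    rw [← smul_incl hmul hone m, map_smul, smul_eq_incl hmul']
    rfl
  refine LinearMap.finrank_le_finrank_of_injective (f := g) fun m m' h => ?_
  apply incl_injective hmul hone
  apply f.injective
  rw [← hg, ← hg, h]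

end CornerCoind

theorem not_hasFiniteRepType_of_corner [FiniteDimensional k A] (e : A) (M : ℕ → Type u)
    [∀ n, AddCommGroup (M n)] [∀ n, Module k (M n)] [∀ n, FiniteDimensional k (M n)]
    [∀ n, Nontrivial (M n)] (ρ : ∀ n, A →ₗ[k] Module.End k (M n))
    (hone : ∀ n, ρ n 1 = 1) (hmul : ∀ n a b, ρ n (a * e * b) = ρ n a * ρ n b)
    (hind : ∀ n (π : Module.End k (M n)), π * π = π → (∀ a, π * ρ n a = ρ n a * π) →
      π = 0 ∨ π = 1)
    (hinj : Function.Injective fun n => Module.finrank k (M n)) : ¬ HasFiniteRepType k A := by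
  rintro ⟨N, V, hV⟩
  have h (n) := hV (CornerCoind e (ρ n)) inferInstance
    (CornerCoind.isIndecomposable (hmul n) (hone n) (hind n))
  choose i hi using h
  obtain ⟨n, n', hne, hnn⟩ := Finite.exists_ne_map_eq_of_infinite i
  obtain ⟨f⟩ := hi n
  obtain ⟨f'⟩ := hi n'
  rw [← hnn] at f'
  let F := f.trans f'.symm
  exact hne (hinj (le_antisymm
    (CornerCoind.finrank_le_of_linearEquiv (hmul n) (hone n) (hmul n') F)
    (CornerCoind.finrank_le_of_linearEquiv (hmul n') (hone n') (hmul n) F.symm)))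

end Coinduction

section DoubleLoop

/-- Coordinates on the corner `e A e` of an algebra modulo the square of its radical, when the
corner has two primitive idempotents with a loop at each of them (`α₁`, `β₁`) and one arrow in each
direction between them (`c`, `d`). -/
structure DoubleLoopCorner (k : Type u) [Field k] {A : Type u} [Ring A] [Algebra k A]
    (e : A) where
  (α₀ α₁ β₀ β₁ c d : A →ₗ[k] k)
  one_eq : α₀ 1 = 1 ∧ α₁ 1 = 0 ∧ β₀ 1 = 1 ∧ β₁ 1 = 0 ∧ c 1 = 0 ∧ d 1 = 0
  α₀_mul : ∀ a b, α₀ (a * e * b) = α₀ a * α₀ b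
  α₁_mul : ∀ a b, α₁ (a * e * b) = α₀ a * α₁ b + α₁ a * α₀ b
  β₀_mul : ∀ a b, β₀ (a * e * b) = β₀ a * β₀ b
  β₁_mul : ∀ a b, β₁ (a * e * b) = β₀ a * β₁ b + β₁ a * β₀ b
  c_mul : ∀ a b, c (a * e * b) = α₀ a * c b + c a * β₀ b
  d_mul : ∀ a b, d (a * e * b) = β₀ a * d b + d a * α₀ b
  exists_eq : ∀ v₀ v₁ v₂ v₃ v₄ v₅ : k,
    ∃ a, α₀ a = v₀ ∧ α₁ a = v₁ ∧ β₀ a = v₂ ∧ β₁ a = v₃ ∧ c a = v₄ ∧ d a = v₅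

namespace DoubleLoopCorner

variable {k A : Type u} [Field k] [Ring A] [Algebra k A] {e : A}
  (D : DoubleLoopCorner k e) {R : Type u} [CommRing R] [Algebra k R] (t : R)

/-- The band representation of the corner with parameter `t`: two copies of `R` at each vertex. -/
def rep : A →ₗ[k] Module.End k (R × R × R × R) where
  toFun a :=
    { toFun := fun u => (D.α₀ a • u.1, D.α₀ a • u.2.1 + D.α₁ a • u.1 + D.c a • u.2.2.1,
        D.β₀ a • u.2.2.1, D.β₀ a • u.2.2.2 + D.β₁ a • u.2.2.1 + D.d a • (t * u.1))
      map_add' := fun u v => by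
        simp only [Prod.fst_add, Prod.snd_add, Prod.mk_add_mk, Prod.mk.injEq, mul_add]
        refine ⟨?_, ?_, ?_, ?_⟩ <;> module
      map_smul' := fun s u => by
        simp only [Prod.smul_fst, Prod.smul_snd, Prod.smul_mk, Prod.mk.injEq, RingHom.id_apply,
          mul_smul_comm]
        refine ⟨?_, ?_, ?_, ?_⟩ <;> module }
  map_add' a b := by
    refine LinearMap.ext fun u => ?_
    simp only [map_add, LinearMap.coe_mk, AddHom.coe_mk, LinearMap.add_apply, Prod.mk_add_mk,
      Prod.mk.injEq]
    refine ⟨?_, ?_, ?_, ?_⟩ <;> module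
  map_smul' s a := by
    refine LinearMap.ext fun u => ?_
    simp only [map_smul, LinearMap.coe_mk, AddHom.coe_mk, LinearMap.smul_apply, Prod.smul_mk,
      Prod.mk.injEq, RingHom.id_apply, smul_eq_mul]
    refine ⟨?_, ?_, ?_, ?_⟩ <;> module

theorem rep_apply (a : A) (u₀ u₁ w₀ w₁ : R) :
    D.rep t a (u₀, u₁, w₀, w₁) = (D.α₀ a • u₀, D.α₀ a • u₁ + D.α₁ a • u₀ + D.c a • w₀,
      D.β₀ a • w₀, D.β₀ a • w₁ + D.β₁ a • w₀ + D.d a • (t * u₀)) := rfl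

theorem rep_one : D.rep t 1 = 1 := by
  obtain ⟨h₀, h₁, h₂, h₃, h₄, h₅⟩ := D.one_eq
  refine LinearMap.ext fun ⟨u₀, u₁, w₀, w₁⟩ => ?_
  simp [rep_apply, h₀, h₁, h₂, h₃, h₄, h₅]

theorem rep_mul (a b : A) : D.rep t (a * e * b) = D.rep t a * D.rep t b := by
  refine LinearMap.ext fun ⟨u₀, u₁, w₀, w₁⟩ => ?_
  simp only [Module.End.mul_apply, rep_apply, D.α₀_mul, D.α₁_mul, D.β₀_mul, D.β₁_mul, D.c_mul,
    D.d_mul, mul_smul_comm, Prod.mk.injEq]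
  refine ⟨?_, ?_, ?_, ?_⟩ <;> module

/-- An endomorphism of a band representation is, up to a nilpotent one, an endomorphism `σ` of
`R` commuting with the parameter. -/
theorem exists_of_commute (π : Module.End k (R × R × R × R))
    (hπ : ∀ a, π * D.rep t a = D.rep t a * π) :
    ∃ σ τ τ' : Module.End k R, (∀ u, σ (t * u) = t * σ u) ∧ ∀ u₀ u₁ w₀ w₁,
      π (u₀, u₁, w₀, w₁) = (σ u₀, σ u₁ + τ u₀, σ w₀, σ w₁ + τ' w₀) := by
  have hπ' (a u) : π (D.rep t a u) = D.rep t a (π u) := LinearMap.congr_fun (hπ a) u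
  have key (v₀ v₁ v₂ v₃ v₄ v₅ : k) (u₀ u₁ w₀ w₁ : R) :
      π (v₀ • u₀, v₀ • u₁ + v₁ • u₀ + v₄ • w₀, v₂ • w₀, v₂ • w₁ + v₃ • w₀ + v₅ • (t * u₀)) =
      (v₀ • (π (u₀, u₁, w₀, w₁)).1, v₀ • (π (u₀, u₁, w₀, w₁)).2.1 +
        v₁ • (π (u₀, u₁, w₀, w₁)).1 + v₄ • (π (u₀, u₁, w₀, w₁)).2.2.1,
        v₂ • (π (u₀, u₁, w₀, w₁)).2.2.1, v₂ • (π (u₀, u₁, w₀, w₁)).2.2.2 +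
        v₃ • (π (u₀, u₁, w₀, w₁)).2.2.1 + v₅ • (t * (π (u₀, u₁, w₀, w₁)).1)) := by
    obtain ⟨a, rfl, rfl, rfl, rfl, rfl, rfl⟩ := D.exists_eq v₀ v₁ v₂ v₃ v₄ v₅
    rw [← rep_apply, hπ']
    rfl
  let i₀ : R →ₗ[k] R × R × R × R := LinearMap.inl k R (R × R × R)
  let i₂ : R →ₗ[k] R × R × R × R :=
    LinearMap.inr k R (R × R × R) ∘ₗ LinearMap.inr k R (R × R) ∘ₗ LinearMap.inl k R R
  let σ : Module.End k R := LinearMap.fst k R _ ∘ₗ π ∘ₗ i₀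
  let τ : Module.End k R := LinearMap.fst k R _ ∘ₗ LinearMap.snd k R _ ∘ₗ π ∘ₗ i₀
  let σ' : Module.End k R :=
    LinearMap.fst k R _ ∘ₗ LinearMap.snd k R _ ∘ₗ LinearMap.snd k R _ ∘ₗ π ∘ₗ i₂
  let τ' : Module.End k R :=
    LinearMap.snd k R _ ∘ₗ LinearMap.snd k R _ ∘ₗ LinearMap.snd k R _ ∘ₗ π ∘ₗ i₂
  have h0 (u : R) : π (u, 0, 0, 0) = (σ u, τ u, 0, 0) := by
    have := key 1 0 0 0 0 0 u 0 0 0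
    simp only [one_smul, zero_smul, smul_zero, add_zero] at this
    exact this
  have h2 (u : R) : π (0, 0, u, 0) = (0, 0, σ' u, τ' u) := by
    have := key 0 0 1 0 0 0 0 0 u 0
    simp only [one_smul, zero_smul, smul_zero, add_zero, mul_zero] at this
    exact this
  have h1 (u : R) : π (0, u, 0, 0) = (0, σ u, 0, 0) := by
    have := key 0 1 0 0 0 0 u 0 0 0
    simpa [h0] using this
  have h1' (u : R) : π (0, u, 0, 0) = (0, σ' u, 0, 0) := by
    have := key 0 0 0 0 1 0 0 0 u 0
    simpa [h2] using this
  have h3 (u : R) : π (0, 0, 0, u) = (0, 0, 0, σ' u) := by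
    have := key 0 0 0 1 0 0 0 0 u 0
    simpa [h2] using this
  have h3' (u : R) : π (0, 0, 0, t * u) = (0, 0, 0, t * σ u) := by
    have := key 0 0 0 0 0 1 u 0 0 0
    simpa [h0] using this
  have hσ (u : R) : σ' u = σ u := by
    have := (h1' u).symm.trans (h1 u)
    simpa using this
  refine ⟨σ, τ, τ', fun u => ?_, fun u₀ u₁ w₀ w₁ => ?_⟩
  · have := (h3 (t * u)).symm.trans (h3' u)
    rw [← hσ]
    simpa using this
  · have : ((u₀, u₁, w₀, w₁) : R × R × R × R) =
      (u₀, 0, 0, 0) + (0, u₁, 0, 0) + (0, 0, w₀, 0) + (0, 0, 0, w₁) := by simp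
    rw [this, map_add, map_add, map_add, h0, h1, h2, h3, hσ, hσ]
    simp only [Prod.mk_add_mk, add_zero, zero_add, add_comm (τ u₀), add_comm (τ' w₀)]

theorem eq_zero_or_eq_one_of_commute (ht : Algebra.adjoin k {t} = ⊤)
    (hR : ∀ r : R, r * r = r → r = 0 ∨ r = 1) (π : Module.End k (R × R × R × R))
    (hidem : π * π = π) (hπ : ∀ a, π * D.rep t a = D.rep t a * π) : π = 0 ∨ π = 1 := by
  obtain ⟨σ, τ, τ', hσ, h⟩ := D.exists_of_commute t π hπ
  have hlin (r u : R) : σ (r * u) = r * σ u := by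
    have hr : r ∈ Algebra.adjoin k {t} := ht ▸ Algebra.mem_top
    induction hr using Algebra.adjoin_induction generalizing u with
    | mem x hx => obtain rfl := hx; exact hσ u
    | algebraMap s => simp [Algebra.algebraMap_eq_smul_one]
    | add x y _ _ hx hy => simp [add_mul, hx, hy]
    | mul x y _ _ hx hy => rw [mul_assoc, hx, hy, mul_assoc]
  have hσ1 (u : R) : σ u = u * σ 1 := by simpa using hlin u 1
  have hi (u₀ u₁ w₀ w₁ : R) := LinearMap.congr_fun hidem (u₀, u₁, w₀, w₁)
  simp only [Module.End.mul_apply, h, map_add, Prod.mk.injEq] at hi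
  have hid : σ 1 * σ 1 = σ 1 := by
    have := (hi 1 0 0 0).1
    rwa [hσ1 (σ 1)] at this
  rcases hR _ hid with h0 | h1
  · left
    have hz (u) : σ u = 0 := by rw [hσ1, h0, mul_zero]
    refine LinearMap.ext fun ⟨u₀, u₁, w₀, w₁⟩ => ?_
    have := hi u₀ u₁ w₀ w₁
    simp only [hz, map_zero, zero_add] at this
    simp [h, hz, ← this.2.1, ← this.2.2.2]
  · right
    have hz (u) : σ u = u := by rw [hσ1, h1, mul_one]
    refine LinearMap.ext fun ⟨u₀, u₁, w₀, w₁⟩ => ?_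
    have := hi u₀ u₁ w₀ w₁
    simp only [hz] at this
    have e1 : τ u₀ = 0 := by simpa using this.2.1
    have e2 : τ' w₀ = 0 := by simpa using this.2.2.2
    simp [h, hz, e1, e2]

end DoubleLoopCorner

theorem AdjoinRoot.eq_zero_or_eq_one_of_idempotent {k : Type*} [Field k] (n : ℕ)
    (r : AdjoinRoot ((Polynomial.X : Polynomial k) ^ n)) (hr : r * r = r) : r = 0 ∨ r = 1 := by
  obtain ⟨f, rfl⟩ := AdjoinRoot.mk_surjective r
  have h : (Polynomial.X : Polynomial k) ^ n ∣ f * (1 - f) := by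
    rw [← AdjoinRoot.mk_eq_zero]
    simp [mul_sub, hr]
  by_cases hf : Polynomial.X ∣ f
  · left
    have h1 : ¬ Polynomial.X ∣ 1 - f := fun h1 => by
      have := dvd_add hf h1
      rw [add_sub_cancel] at this
      exact Polynomial.not_isUnit_X (isUnit_of_dvd_one this)
    exact AdjoinRoot.mk_eq_zero.mpr (Polynomial.prime_X.pow_dvd_of_dvd_mul_right n h1 h)
  · right
    have := AdjoinRoot.mk_eq_zero.mpr (Polynomial.prime_X.pow_dvd_of_dvd_mul_left n hf h)
    rw [map_sub, map_one, sub_eq_zero] at this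
    exact this.symm

theorem DoubleLoopCorner.not_hasFiniteRepType {k A : Type u} [Field k] [Ring A] [Algebra k A]
    [FiniteDimensional k A] {e : A} (D : DoubleLoopCorner k e) : ¬ HasFiniteRepType k A := by
  let R (n : ℕ) : Type u := AdjoinRoot ((Polynomial.X : Polynomial k) ^ (n + 1))
  have hX (n : ℕ) : (Polynomial.X : Polynomial k) ^ (n + 1) ≠ 0 :=
    pow_ne_zero _ Polynomial.X_ne_zero
  have hfin (n : ℕ) : FiniteDimensional k (R n) := (AdjoinRoot.powerBasis (hX n)).finite
  have hrank (n : ℕ) : Module.finrank k (R n) = n + 1 := by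
    rw [(AdjoinRoot.powerBasis (hX n)).finrank, AdjoinRoot.powerBasis_dim]
    simp
  have hnt (n : ℕ) : Nontrivial (R n) := 
    Module.nontrivial_of_finrank_pos (R := k) (by rw [hrank]; exact n.succ_pos)
  refine not_hasFiniteRepType_of_corner e (fun n => R n × R n × R n × R n)
    (fun n => D.rep (AdjoinRoot.root _)) (fun n => D.rep_one _) (fun n => D.rep_mul _)
    (fun n => D.eq_zero_or_eq_one_of_commute _ AdjoinRoot.adjoinRoot_eq_top
      (AdjoinRoot.eq_zero_or_eq_one_of_idempotent _)) fun n n' h => ?_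
  simp only [Module.finrank_prod, hrank] at h
  omega

end DoubleLoop

namespace CohMackey

/-- The `0`-`1` matrix supported on the `G`-orbit of `(o, o')`. -/
noncomputable def orbitMatrix (k : Type*) {G X : Type*} [Field k] [Group G] [MulAction G X]
    (o o' : X) : Matrix X X k :=
  open Classical in fun x y => if ∃ g : G, g • o = x ∧ g • o' = y then 1 else 0

section

variable {k G : Type u} [Field k] [Group G] [Finite G]

theorem exists_toMatrix_eq_orbitMatrix (o o' : Σ H : Subgroup G, G ⧸ H) :
    ∃ a : CohMackey k G, toMatrix a = orbitMatrix (G := G) k o o' := by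
  refine exists_toMatrix_eq _ fun g x y => ?_
  unfold orbitMatrix
  congr 1
  refine propext ⟨fun ⟨h, h₁, h₂⟩ => ⟨g⁻¹ * h, ?_, ?_⟩, fun ⟨h, h₁, h₂⟩ => ⟨g * h, ?_, ?_⟩⟩
  · rw [mul_smul, h₁, inv_smul_smul]
  · rw [mul_smul, h₂, inv_smul_smul]
  · rw [mul_smul, h₁]
  · rw [mul_smul, h₂]

end

section Corner

variable {k G : Type u} [Field k] [CommGroup G] (H : Subgroup G)

/-- The point `g` of the free orbit. -/
def freePt (g : G) : Σ H : Subgroup G, G ⧸ H := ⟨⊥, (g : G ⧸ (⊥ : Subgroup G))⟩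

/-- The point `x` of the orbit `G ⧸ H`. -/
def cosetPt (x : G ⧸ H) : Σ H : Subgroup G, G ⧸ H := ⟨H, x⟩

theorem smul_freePt (g h : G) : g • freePt h = freePt (g * h) := rfl

theorem smul_cosetPt (g : G) (x : G ⧸ H) : g • cosetPt H x = cosetPt H (g * x) := by
  induction x using QuotientGroup.induction_on with
  | H x => rfl

theorem freePt_injective : Function.Injective (freePt (G := G)) := by
  intro g h hgh
  have : (g : G ⧸ (⊥ : Subgroup G)) = h := by simpa [freePt] using hgh
  rw [QuotientGroup.eq] at this
  exact (inv_mul_eq_one.mp (Subgroup.mem_bot.mp this))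

theorem cosetPt_injective : Function.Injective (cosetPt H) := by
  intro g h hgh
  simpa [cosetPt] using hgh

variable {H}

theorem freePt_ne_cosetPt (hH : H ≠ ⊥) (g : G) (x : G ⧸ H) : freePt g ≠ cosetPt H x := by
  intro h
  exact hH (congrArg Sigma.fst h).symm

theorem toMatrix_coset_coset (a : CohMackey k G) (x y z : G ⧸ H) :
    toMatrix a (cosetPt H (z * x)) (cosetPt H (z * y)) =
      toMatrix a (cosetPt H x) (cosetPt H y) := by
  induction z using QuotientGroup.induction_on with
  | H z => rw [← smul_cosetPt, ← smul_cosetPt, toMatrix_smul_smul]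

theorem toMatrix_free_free (a : CohMackey k G) (x y z : G) :
    toMatrix a (freePt (z * x)) (freePt (z * y)) = toMatrix a (freePt x) (freePt y) := by
  rw [← smul_freePt, ← smul_freePt, toMatrix_smul_smul]

theorem toMatrix_coset_free (a : CohMackey k G) (x : G ⧸ H) (y z : G) :
    toMatrix a (cosetPt H (z * x)) (freePt (z * y)) = toMatrix a (cosetPt H x) (freePt y) := by
  rw [← smul_cosetPt, ← smul_freePt, toMatrix_smul_smul]

theorem toMatrix_free_coset (a : CohMackey k G) (x : G) (y : G ⧸ H) (z : G) :
    toMatrix a (freePt (z * x)) (cosetPt H (z * y)) = toMatrix a (freePt x) (cosetPt H y) := by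
  rw [← smul_cosetPt, ← smul_freePt, toMatrix_smul_smul]

theorem exists_toMatrix_mul_mul [Fintype G] [∀ K : Subgroup G, Fintype (G ⧸ K)]
    (hH : H ≠ ⊥) :
    ∃ e : CohMackey k G, ∀ (a b : CohMackey k G) x z, toMatrix (a * e * b) x z =
      ∑ y, toMatrix a x (cosetPt H y) * toMatrix b (cosetPt H y) z +
      ∑ g, toMatrix a x (freePt g) * toMatrix b (freePt g) z := by
  classical
  have := Fintype.ofFinite (Subgroup G)
  obtain ⟨e, he⟩ := exists_toMatrix_eq (k := k) (G := G)
    (Matrix.diagonal fun x => if x.1 = H ∨ x.1 = ⊥ then 1 else 0) (fun g x y => by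
      simp only [Matrix.diagonal_apply, smul_left_cancel_iff]
      rfl)
  refine ⟨e, fun a b x z => ?_⟩
  rw [toMatrix_mul, toMatrix_mul, he, Matrix.mul_apply, Fintype.sum_sigma,
    Fintype.sum_eq_add H ⊥ hH]
  · congr 1
    · simp [Matrix.mul_diagonal, cosetPt]
    · refine (Fintype.sum_equiv QuotientGroup.quotientBot.symm.toEquiv _ _ fun g => ?_).symm
      simp [Matrix.mul_diagonal, freePt]
  · rintro K ⟨h₁, h₂⟩
    simp [Matrix.mul_diagonal, h₁, h₂]

theorem sum_comp_mk [Fintype G] [Fintype (G ⧸ H)] (hcard : (Nat.card H : k) = 0) (f : G ⧸ H → k) :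
    ∑ g : G, f g = 0 := by
  classical
  have := Fintype.ofFinite H
  rw [Fintype.sum_equiv Subgroup.groupEquivQuotientProdSubgroup (fun g : G => f g)
    (fun z : (G ⧸ H) × H => f z.1) (fun g => rfl), Fintype.sum_prod_type]
  simp only [Finset.sum_const, Finset.card_univ, ← Nat.card_eq_fintype_card, nsmul_eq_mul, hcard,
    zero_mul, mul_zero]

/-- The entry of the matrix of an element of `CohMackey k G`, as a linear functional. -/
noncomputable def entry (x y : Σ H : Subgroup G, G ⧸ H) : CohMackey k G →ₗ[k] k :=
  Matrix.entryLinearMap k k x y ∘ₗ toMatrix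

theorem entry_apply (x y : Σ H : Subgroup G, G ⧸ H) (a : CohMackey k G) :
    entry x y a = toMatrix a x y := rfl

theorem orbitMatrix_coset_coset (y : G ⧸ H) (z : G) :
    orbitMatrix (G := G) k (cosetPt H 1) (cosetPt H z) (cosetPt H 1) (cosetPt H y) =
      open Classical in if y = z then 1 else 0 := by
  unfold orbitMatrix
  congr 1
  simp only [smul_cosetPt, (cosetPt_injective H).eq_iff, mul_one]
  refine propext ⟨?_, ?_⟩
  · rintro ⟨g, hg, rfl⟩
    rw [hg, one_mul]
  · rintro rfl
    exact ⟨1, rfl, by simp⟩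

theorem orbitMatrix_free_free (y z : G) :
    orbitMatrix (G := G) k (freePt 1) (freePt z) (freePt 1) (freePt y) =
      open Classical in if y = z then 1 else 0 := by
  unfold orbitMatrix
  congr 1
  simp only [smul_freePt, freePt_injective.eq_iff, mul_one, exists_eq_left, one_mul]
  exact propext eq_comm

theorem orbitMatrix_coset_free (x : G ⧸ H) :
    orbitMatrix (G := G) k (cosetPt H 1) (freePt 1) (cosetPt H x) (freePt 1) =
      open Classical in if x = 1 then 1 else 0 := by
  unfold orbitMatrix
  congr 1
  simp only [smul_freePt, smul_cosetPt, freePt_injective.eq_iff, (cosetPt_injective H).eq_iff,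
    mul_one, exists_eq_right]
  exact propext eq_comm

theorem orbitMatrix_free_coset (x : G ⧸ H) :
    orbitMatrix (G := G) k (freePt 1) (cosetPt H 1) (freePt 1) (cosetPt H x) =
      open Classical in if x = 1 then 1 else 0 := by
  unfold orbitMatrix
  congr 1
  simp only [smul_freePt, smul_cosetPt, freePt_injective.eq_iff, (cosetPt_injective H).eq_iff,
    mul_one, exists_eq_left]
  exact propext eq_comm

theorem orbitMatrix_eq_zero_left {o o' x y : Σ H : Subgroup G, G ⧸ H} (h : o.1 ≠ x.1) :
    orbitMatrix (G := G) k o o' x y = 0 :=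
  if_neg fun ⟨g, hg, _⟩ => h (congrArg Sigma.fst hg : (g • o).1 = x.1)

theorem orbitMatrix_eq_zero_right {o o' x y : Σ H : Subgroup G, G ⧸ H} (h : o'.1 ≠ y.1) :
    orbitMatrix (G := G) k o o' x y = 0 :=
  if_neg fun ⟨g, _, hg⟩ => h (congrArg Sigma.fst hg : (g • o').1 = y.1)

theorem exists_doubleLoopCorner [Fintype G] (hcard : (Nat.card H : k) = 0) (lam : G ⧸ H → k)
    (hlam : ∀ x y, lam (x * y) = lam x + lam y) (γ : G) (hγ : lam γ ≠ 0) :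
    ∃ e : CohMackey k G, Nonempty (DoubleLoopCorner k e) := by
  classical
  have := Fintype.ofFinite (Subgroup G)
  have (K : Subgroup G) := Fintype.ofFinite (G ⧸ K)
  have hH : H ≠ ⊥ := by
    rintro rfl
    simp at hcard
  have hlam1 : lam 1 = 0 := by simpa using hlam 1 1
  obtain ⟨e, he⟩ := exists_toMatrix_mul_mul (k := k) hH
  have hP (a : CohMackey k G) (x y : G ⧸ H) : toMatrix a (cosetPt H x) (cosetPt H (x * y)) =
      toMatrix a (cosetPt H 1) (cosetPt H y) := by
    simpa using toMatrix_coset_coset a 1 y x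
  have hR (a : CohMackey k G) (x y : G) : toMatrix a (freePt x) (freePt (x * y)) =
      toMatrix a (freePt 1) (freePt y) := by
    simpa using toMatrix_free_free a 1 y x
  have hC (a : CohMackey k G) (x : G ⧸ H) (g : G) : toMatrix a (cosetPt H x) (freePt g) =
      toMatrix a (cosetPt H ((g : G ⧸ H)⁻¹ * x)) (freePt 1) := by
    simpa using toMatrix_coset_free a ((g : G ⧸ H)⁻¹ * x) 1 g
  have hS (a : CohMackey k G) (g : G) (x : G ⧸ H) : toMatrix a (freePt g) (cosetPt H x) =
      toMatrix a (freePt 1) (cosetPt H ((g : G ⧸ H)⁻¹ * x)) := by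
    simpa using toMatrix_free_coset a 1 ((g : G ⧸ H)⁻¹ * x) g
  have hPsum (a : CohMackey k G) (f : G ⧸ H → k) (x : G ⧸ H) :
      ∑ z, toMatrix a (cosetPt H x) (cosetPt H z) * f z =
        ∑ z, toMatrix a (cosetPt H 1) (cosetPt H z) * f (x * z) :=
    (Fintype.sum_equiv (Equiv.mulLeft x) _ _ fun z => by simp [hP]).symm
  have hRsum (a : CohMackey k G) (f : G → k) (x : G) :
      ∑ z, toMatrix a (freePt x) (freePt z) * f z =
        ∑ z, toMatrix a (freePt 1) (freePt z) * f (x * z) :=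
    (Fintype.sum_equiv (Equiv.mulLeft x) _ _ fun z => by simp [hR]).symm
  have hSsum (a : CohMackey k G) (f : G ⧸ H → k) (g : G) :
      ∑ z, toMatrix a (freePt g) (cosetPt H z) * f z =
        ∑ z, toMatrix a (freePt 1) (cosetPt H z) * f (g * z) :=
    (Fintype.sum_equiv (Equiv.mulLeft (g : G ⧸ H)) _ _ fun z => by simp [hS a g]).symm
  have hP' (a : CohMackey k G) (y : G ⧸ H) : ∑ x, toMatrix a (cosetPt H x) (cosetPt H y) =
      ∑ x, toMatrix a (cosetPt H 1) (cosetPt H x) :=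
    Fintype.sum_equiv ((Equiv.inv _).trans (Equiv.mulRight y)) _ _ fun x => by
      rw [← hP a x]
      simp
  have hR' (a : CohMackey k G) : ∑ x, toMatrix a (freePt x) (freePt 1) =
      ∑ x, toMatrix a (freePt 1) (freePt x) :=
    Fintype.sum_equiv (Equiv.inv _) _ _ fun x => by
      rw [← hR a x]
      simp
  have hC' (a : CohMackey k G) (g : G) : ∑ x, toMatrix a (cosetPt H x) (freePt g) =
      ∑ x, toMatrix a (cosetPt H x) (freePt 1) :=
    Fintype.sum_equiv (Equiv.mulLeft (g : G ⧸ H)⁻¹) _ _ fun x => by simp [hC a x g]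
  let A (f : G ⧸ H → k) : CohMackey k G →ₗ[k] k :=
    ∑ y, f y • entry (cosetPt H 1) (cosetPt H y)
  let B (f : G ⧸ H → k) : CohMackey k G →ₗ[k] k :=
    ∑ y : G, f y • entry (freePt 1) (freePt y)
  let c : CohMackey k G →ₗ[k] k := ∑ x, entry (cosetPt H x) (freePt 1)
  let d : CohMackey k G →ₗ[k] k := ∑ x, entry (freePt 1) (cosetPt H x)
  have hA (f a) : A f a = ∑ y, toMatrix a (cosetPt H 1) (cosetPt H y) * f y := by
    simp [A, entry_apply, mul_comm]
  have hB (f a) : B f a = ∑ y : G, toMatrix a (freePt 1) (freePt y) * f y := by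
    simp [B, entry_apply, mul_comm]
  have hc (a) : c a = ∑ x, toMatrix a (cosetPt H x) (freePt 1) := by
    simp [c, entry_apply]
  have hd (a) : d a = ∑ x, toMatrix a (freePt 1) (cosetPt H x) := by
    simp [d, entry_apply]
  have hA_mul (f a b) : A f (a * e * b) = ∑ y, toMatrix a (cosetPt H 1) (cosetPt H y) *
      ∑ z, toMatrix b (cosetPt H 1) (cosetPt H z) * f (y * z) := by
    simp only [hA, he, add_mul, Finset.sum_add_distrib, Finset.sum_mul]
    rw [Finset.sum_comm, Finset.sum_comm (t := Finset.univ (α := G))]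
    simp only [mul_assoc, ← Finset.mul_sum, hPsum b f, hSsum b f]
    rw [add_eq_left]
    simp only [hC a 1]
    exact sum_comp_mk hcard fun g => toMatrix a (cosetPt H (g⁻¹ * 1)) (freePt 1) *
      ∑ z, toMatrix b (freePt 1) (cosetPt H z) * f (g * z)
  have hB_mul (f a b) : B f (a * e * b) = ∑ y : G, toMatrix a (freePt 1) (freePt y) *
      ∑ z : G, toMatrix b (freePt 1) (freePt z) * f (y * z) := by
    simp only [hB, he, add_mul, Finset.sum_add_distrib, Finset.sum_mul]
    rw [Finset.sum_comm, Finset.sum_comm (γ := G)]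
    simp only [mul_assoc, ← Finset.mul_sum, hRsum b (fun z => f z), QuotientGroup.mk_mul]
    rw [add_eq_right]
    · refine Finset.sum_eq_zero fun y _ => ?_
      simp only [hC b y]
      rw [sum_comp_mk hcard fun g => toMatrix b (cosetPt H (g⁻¹ * y)) (freePt 1) * f g, mul_zero]
  refine ⟨e, ⟨A 1, A lam, B 1, B lam, c, d, ?_, ?_, ?_, ?_, ?_, ?_, ?_, ?_⟩⟩
  · simp [hA, hB, hc, hd, toMatrix_one, Matrix.one_apply, (cosetPt_injective H).eq_iff,
      freePt_injective.eq_iff, freePt_ne_cosetPt hH, (freePt_ne_cosetPt hH _ _).symm, hlam1]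
  · intro a b
    simp [hA_mul, hA, Finset.sum_mul]
  · intro a b
    simp only [hA_mul, hA, Finset.sum_mul, hlam, mul_add, Finset.sum_add_distrib,
      Pi.one_apply, mul_one, Finset.mul_sum]
    rw [add_comm]
    congr 1 <;> exact Finset.sum_comm.trans <|
      Finset.sum_congr rfl fun _ _ => Finset.sum_congr rfl fun _ _ => by ring
  · intro a b
    simp [hB_mul, hB, Finset.sum_mul]
  · intro a b
    simp only [hB_mul, hB, Finset.sum_mul, hlam, mul_add, Finset.sum_add_distrib,
      Pi.one_apply, mul_one, Finset.mul_sum]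
    rw [add_comm]
    congr 1 <;> exact Finset.sum_comm.trans <|
      Finset.sum_congr rfl fun _ _ => Finset.sum_congr rfl fun _ _ => by ring
  · intro a b
    simp only [hc, he, Finset.sum_add_distrib, hA, hB, Pi.one_apply, mul_one]
    rw [Finset.sum_comm, Finset.sum_comm (t := Finset.univ (α := G))]
    simp only [← Finset.sum_mul, hP', hC', ← Finset.mul_sum, hR']
  · intro a b
    simp only [hd, he, Finset.sum_add_distrib, hA, hB, Pi.one_apply, mul_one]
    rw [Finset.sum_comm, Finset.sum_comm (t := Finset.univ (α := G))]
    have h₁ (x) := hPsum b 1 x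
    have h₂ (x) := hSsum b 1 x
    simp only [Pi.one_apply, mul_one] at h₁ h₂
    simp only [← Finset.mul_sum, h₁, h₂, ← Finset.sum_mul]
    rw [add_comm]
  · intro v₀ v₁ v₂ v₃ v₄ v₅
    obtain ⟨a₁, h₁⟩ := exists_toMatrix_eq_orbitMatrix (k := k) (cosetPt H 1) (cosetPt H 1)
    obtain ⟨a₂, h₂⟩ := exists_toMatrix_eq_orbitMatrix (k := k) (cosetPt H 1) (cosetPt H γ)
    obtain ⟨a₃, h₃⟩ := exists_toMatrix_eq_orbitMatrix (k := k) (G := G) (freePt 1) (freePt 1)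
    obtain ⟨a₄, h₄⟩ := exists_toMatrix_eq_orbitMatrix (k := k) (freePt 1) (freePt γ)
    obtain ⟨a₅, h₅⟩ := exists_toMatrix_eq_orbitMatrix (k := k) (cosetPt H 1) (freePt 1)
    obtain ⟨a₆, h₆⟩ := exists_toMatrix_eq_orbitMatrix (k := k) (freePt 1) (cosetPt H 1)
    refine ⟨(v₀ - v₁ / lam γ) • a₁ + (v₁ / lam γ) • a₂ + (v₂ - v₃ / lam γ) • a₃ +
      (v₃ / lam γ) • a₄ + v₄ • a₅ + v₅ • a₆, ?_⟩
    have hl {o o' x y : Σ H : Subgroup G, G ⧸ H} (h : o.1 ≠ x.1) :=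
      orbitMatrix_eq_zero_left (k := k) (o' := o') (y := y) h
    have hr {o o' x y : Σ H : Subgroup G, G ⧸ H} (h : o'.1 ≠ y.1) :=
      orbitMatrix_eq_zero_right (k := k) (o := o) (x := x) h
    have hcc (x) := orbitMatrix_coset_coset (k := k) (H := H) x 1
    rw [QuotientGroup.mk_one] at hcc
    have hff (x) := orbitMatrix_free_free (k := k) (G := G) x 1
    have hcc' (x) := orbitMatrix_coset_coset (k := k) (H := H) x γ
    have hff' (x) := orbitMatrix_free_free (k := k) (G := G) x γ
    have hlf (o' y x g) := hl (o := cosetPt H x) (o' := o') (x := freePt g) (y := y) hH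
    have hlc (o' y x g) := hl (x := cosetPt H x) (o' := o') (o := freePt g) (y := y) hH.symm
    have hrf (o y x g) := hr (o' := cosetPt H x) (o := o) (y := freePt g) (x := y) hH
    have hrc (o y x g) := hr (y := cosetPt H x) (o := o) (o' := freePt g) (x := y) hH.symm
    simp only [map_add, map_smul, Matrix.add_apply, Matrix.smul_apply, smul_eq_mul, hA, hB,
      hc, hd, h₁, h₂, h₃, h₄, h₅, h₆, hlf, hlc, hrf, hrc, orbitMatrix_coset_free,
      orbitMatrix_free_coset, hcc, hff, hcc', hff']
    simp [hlam1, hγ, add_mul, Finset.sum_add_distrib]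

/-- A cyclic group of order `p ^ m` with `m ≥ 2` has infinite representation type. -/
theorem not_hasFiniteRepType_of_isCyclic [Fintype G] {p m : ℕ} (hp : p.Prime) [CharP k p]
    (hcyc : IsCyclic G) (hcard : Fintype.card G = p ^ m) (hm : 2 ≤ m) :
    ¬ HasFiniteRepType k (CohMackey k G) := by
  have hn : Nat.card G = p ^ m := by rw [Nat.card_eq_fintype_card, hcard]
  have hdvd : p ∣ Nat.card G := hn ▸ dvd_pow_self p (by omega)
  let μ : G →* Multiplicative (ZMod p) :=
    (AddMonoidHom.toMultiplicative (ZMod.castHom hdvd (ZMod p)).toAddMonoidHom).comp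
      (zmodCyclicMulEquiv hcyc).symm.toMonoidHom
  have hμ : Function.Surjective μ :=
    (ZMod.castHom_surjective hdvd).comp (zmodCyclicMulEquiv hcyc).symm.surjective
  have := Fact.mk hp
  let ι : ZMod p →+* k := ZMod.castHom dvd_rfl k
  let ψ := QuotientGroup.kerLift μ
  have hker : Nat.card μ.ker * p = p ^ m := by
    rw [← hn, ← Subgroup.card_mul_index μ.ker, Subgroup.index_ker,
      MonoidHom.range_eq_top.mpr hμ]
    simp
  have hker' : Nat.card μ.ker = p ^ (m - 1) := by
    refine Nat.eq_of_mul_eq_mul_right hp.pos ?_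
    rw [hker, ← pow_succ, Nat.sub_add_cancel (by omega)]
  obtain ⟨γ, hγ⟩ := hμ (Multiplicative.ofAdd 1)
  obtain ⟨e, ⟨D⟩⟩ := exists_doubleLoopCorner (k := k) (H := μ.ker)
    (by rw [hker']; simp [show m - 1 ≠ 0 by omega])
    (fun x => ι (ψ x).toAdd) (fun x y => by simp) γ (by
      simp [ψ, hγ])
  exact D.not_hasFiniteRepType

end Corner

end CohMackey

section Splitting

variable {k A N : Type*} [Field k] [Ring A] [Algebra k A] [AddCommGroup N] [Module k N]
  [Module A N] [IsScalarTower k A N]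

/-- A finite family `b` in `N`, permuted up to zero by the elements of `S`, together with a family
of functionals `Φ` whose common kernel is stable under `S` and meets the span of `b` trivially. -/
structure IsSplitFamily {ι : Type*} [Fintype ι] (S : Set A) (b : ι → N) (Φ : ι → N →ₗ[k] k) :
    Prop where
  smul_eq : ∀ s ∈ S, ∀ i, s • b i = 0 ∨ ∃ j, s • b i = b j
  apply_smul : ∀ s ∈ S, ∀ u, (∀ i, Φ i u = 0) → ∀ i, Φ i (s • u) = 0
  eq_zero : ∀ a : ι → k, (∀ i, Φ i (∑ j, a j • b j) = 0) → a = 0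

/-- A subspace stable under a generating set is a submodule. -/
def Submodule.ofAdjoinEqTop {S : Set A} (hS : Algebra.adjoin k S = ⊤) (W : Submodule k N)
    (hW : ∀ s ∈ S, ∀ u ∈ W, s • u ∈ W) : Submodule A N where
  __ := W.toAddSubmonoid
  smul_mem' a u hu := by
    have ha : a ∈ Algebra.adjoin k S := hS ▸ Algebra.mem_top
    suffices ∀ u ∈ W, a • u ∈ W from this u hu
    induction ha using Algebra.adjoin_induction with
    | mem s hs => exact hW s hs
    | algebraMap c =>
      intro u hu
      rw [algebraMap_smul]
      exact W.smul_mem c hu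
    | add a b _ _ ha hb =>
      intro u hu
      rw [add_smul]
      exact W.add_mem (ha u hu) (hb u hu)
    | mul a b _ _ ha hb =>
      intro u hu
      rw [mul_smul]
      exact ha _ (hb u hu)

end Splitting

section

variable {k : Type*} {A N : Type u} [Field k] [Ring A] [Algebra k A] [AddCommGroup N] [Module k N]
  [Module A N] [IsScalarTower k A N]

/-- A nonempty split family in an indecomposable module is a basis. -/
theorem IsSplitFamily.exists_basis {ι : Type*} [Fintype ι] [Nonempty ι] {S : Set A}
    (hS : Algebra.adjoin k S = ⊤) {b : ι → N} {Φ : ι → N →ₗ[k] k} (h : IsSplitFamily S b Φ)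
    (hN : IsIndecomposable (ModuleCat.of A N)) : ∃ b' : Module.Basis ι k N, ⇑b' = b := by
  classical
  have hli : LinearIndependent k b := by
    rw [Fintype.linearIndependent_iff]
    intro a ha i
    rw [h.eq_zero a (by simp [ha]), Pi.zero_apply]
  let W : Submodule k N := Submodule.span k (Set.range b)
  let K : Submodule k N := ⨅ i, LinearMap.ker (Φ i)
  have hK (u) : u ∈ K ↔ ∀ i, Φ i u = 0 := by simp [K]
  have hW : ∀ s ∈ S, ∀ u ∈ W, s • u ∈ W := by
    intro s hs u hu
    have : W ≤ W.comap (Algebra.lsmul k k N s) := by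
      refine Submodule.span_le.mpr ?_
      rintro _ ⟨i, rfl⟩
      change s • b i ∈ W
      obtain h | ⟨j, h⟩ := h.smul_eq s hs i <;> rw [h]
      · exact W.zero_mem
      · exact Submodule.subset_span ⟨j, rfl⟩
    exact this hu
  have hKS : ∀ s ∈ S, ∀ u ∈ K, s • u ∈ K := fun s hs u hu =>
    (hK _).mpr (h.apply_smul s hs u ((hK u).mp hu))
  let T : (ι → k) →ₗ[k] (ι → k) := LinearMap.pi Φ ∘ₗ Fintype.linearCombination k b
  have hT : Function.Surjective T := by
    refine LinearMap.injective_iff_surjective.mp ((injective_iff_map_eq_zero T).mpr fun a ha => ?_)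
    exact h.eq_zero a fun i => congrFun ha i
  have hcompl : IsCompl (W.ofAdjoinEqTop hS hW) (K.ofAdjoinEqTop hS hKS) := by
    constructor
    · rw [Submodule.disjoint_def]
      intro u hu hu'
      obtain ⟨a, rfl⟩ := (Submodule.mem_span_range_iff_exists_fun k).mp hu
      rw [h.eq_zero a ((hK _).mp hu')]
      simp
    · rw [codisjoint_iff, Submodule.eq_top_iff']
      intro u
      obtain ⟨a, ha⟩ := hT (LinearMap.pi Φ u)
      rw [Submodule.mem_sup]
      refine ⟨∑ i, a i • b i, Submodule.mem_span_range_iff_exists_fun k |>.mpr ⟨a, rfl⟩,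
        u - ∑ i, a i • b i, (hK _).mpr fun i => ?_, by abel⟩
      have := congrFun ha i
      simp only [T, LinearMap.comp_apply, LinearMap.pi_apply, Fintype.linearCombination_apply]
        at this
      rw [map_sub, this, sub_self]
  obtain hbot | hbot := hN.eq_bot_or_eq_bot_of_isCompl hcompl
  · obtain ⟨i⟩ := ‹Nonempty ι›
    have hbi : b i ∈ W.ofAdjoinEqTop hS hW := Submodule.subset_span (s := Set.range b) ⟨i, rfl⟩
    rw [hbot, Submodule.mem_bot] at hbi
    exact absurd hbi (hli.ne_zero i)
  · have htop : W = ⊤ := by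
      have := eq_top_of_isCompl_bot (hbot ▸ hcompl)
      rw [Submodule.eq_top_iff'] at this ⊢
      exact this
    exact ⟨Module.Basis.mk hli htop.ge, Module.Basis.coe_mk _ _⟩

end

section

variable {k : Type u} {A : Type u} [Field k] [Ring A] [Algebra k A]

/-- `X` has a basis on which the elements of `S` act by the partial maps `τ`. -/
def HasCode (k : Type u) [Field k] [Algebra k A] {S : Set A} {d : ℕ}
    (τ : S → Fin d → Option (Fin d)) (X : ModuleCat.{u} A) : Prop :=
  ∃ (_ : Module k X) (_ : IsScalarTower k A X) (b : Module.Basis (Fin d) k X),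
    ∀ (s : S) i, (s : A) • b i = (τ s i).elim 0 b

theorem HasCode.nonempty_linearEquiv {S : Set A} (hS : Algebra.adjoin k S = ⊤) {d : ℕ}
    {τ : S → Fin d → Option (Fin d)} {X Y : ModuleCat.{u} A} (hX : HasCode k τ X)
    (hY : HasCode k τ Y) : Nonempty (X ≃ₗ[A] Y) := by
  obtain ⟨_, _, b, hb⟩ := hX
  obtain ⟨_, _, c, hc⟩ := hY
  let φ := b.equiv c (Equiv.refl _)
  refine ⟨{ φ with map_smul' := fun a => ?_ }⟩
  have ha : a ∈ Algebra.adjoin k S := hS ▸ Algebra.mem_top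
  change ∀ u, φ (a • u) = a • φ u
  induction ha using Algebra.adjoin_induction with
  | mem s hs =>
    intro u
    suffices φ.toLinearMap ∘ₗ Algebra.lsmul k k X s = Algebra.lsmul k k Y s ∘ₗ φ.toLinearMap from
      LinearMap.congr_fun this u
    refine b.ext fun i => ?_
    have h₁ := hb ⟨s, hs⟩ i
    have h₂ := hc ⟨s, hs⟩ i
    simp only at h₁ h₂
    simp only [LinearMap.comp_apply, Algebra.lsmul_coe, LinearEquiv.coe_coe, h₁, φ,
      Module.Basis.equiv_apply, Equiv.refl_apply, h₂]
    cases τ ⟨s, hs⟩ i <;> simp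
  | algebraMap c => simp
  | add a b _ _ ha hb => simp [add_smul, ha, hb]
  | mul a b _ _ ha hb => simp [mul_smul, ha, hb]

/-- If every indecomposable module has a nonempty split family of bounded size, then the algebra
has finite representation type. -/
theorem hasFiniteRepType_of_isSplitFamily {S : Set A} (hfin : S.Finite)
    (hS : Algebra.adjoin k S = ⊤) (D : ℕ)
    (h : ∀ (M : Type u) [AddCommGroup M] [Module k M] [Module A M] [IsScalarTower k A M],
      FiniteDimensional k M → IsIndecomposable (ModuleCat.of A M) →
      ∃ (ι : Type) (_ : Fintype ι) (b : ι → M) (Φ : ι → M →ₗ[k] k), Nonempty ι ∧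
        Fintype.card ι ≤ D ∧ IsSplitFamily S b Φ) : HasFiniteRepType k A := by
  classical
  have := hfin.to_subtype
  let Code := Σ d : Fin (D + 1), S → Fin d → Option (Fin d)
  obtain ⟨n, ⟨φ⟩⟩ := Finite.exists_equiv_fin Code
  let V (c : Code) : ModuleCat.{u} A :=
    if h : ∃ X, HasCode k c.2 X then h.choose else ModuleCat.of A PUnit
  refine ⟨n, V ∘ φ.symm, fun M _ _ _ _ hfd hM => ?_⟩
  obtain ⟨ι, _, b, Φ, _, hcard, hb⟩ := h M hfd hM
  obtain ⟨b', hb'⟩ := hb.exists_basis hS hM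
  let ψ := Fintype.equivFin ι
  have hτ (s : S) (i : Fin (Fintype.card ι)) : ∃ o : Option (Fin (Fintype.card ι)),
      (s : A) • b'.reindex ψ i = o.elim 0 (b'.reindex ψ) := by
    simp only [Module.Basis.reindex_apply, hb']
    obtain h | ⟨j, h⟩ := hb.smul_eq s s.2 (ψ.symm i)
    · exact ⟨none, by simpa using h⟩
    · exact ⟨some (ψ j), by simpa [hb'] using h⟩
  choose τ hτ using hτ
  let c : Code := ⟨⟨Fintype.card ι, by omega⟩, τ⟩
  have hc : HasCode k c.2 (ModuleCat.of A M) :=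
    ⟨‹Module k M›, ‹IsScalarTower k A M›, b'.reindex ψ, hτ⟩
  have hV : HasCode k c.2 (V c) := by
    have hex : ∃ X, HasCode k c.2 X := ⟨_, hc⟩
    simp only [V, dif_pos hex]
    exact hex.choose_spec
  refine ⟨φ c, ?_⟩
  rw [Function.comp_apply, Equiv.symm_apply_apply]
  exact hc.nonempty_linearEquiv hS hV

end

/-- The relations satisfied by an idempotent `e`, a nilpotent loop `x` at `e` and two arrows
`r`, `t` joining the vertices `e` and `1 - e` whose composite is `r * t = x ^ l`. -/
structure LoopRelations {A : Type*} [Ring A] (l : ℕ) (e x r t : A) : Prop where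
  e_e : e * e = e
  e_x : e * x = x
  x_e : x * e = x
  e_r : e * r = r
  r_e : r * e = 0
  t_e : t * e = t
  e_t : e * t = 0
  x_r : x * r = 0
  t_x : t * x = 0
  r_t : r * t = x ^ l

namespace LoopRelations

section

variable {k A N : Type*} [Field k] [Ring A] [Algebra k A] [AddCommGroup N] [Module k N]
  [Module A N] [IsScalarTower k A N] {l : ℕ} {e x r t : A}

theorem e_e_smul (h : LoopRelations l e x r t) (u : N) :
    e • e • u = e • u := by
  rw [← mul_smul, h.e_e]

theorem e_x_smul (h : LoopRelations l e x r t) (u : N) :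
    e • x • u = x • u := by
  rw [← mul_smul, h.e_x]

theorem x_e_smul (h : LoopRelations l e x r t) (u : N) :
    x • e • u = x • u := by
  rw [← mul_smul, h.x_e]

theorem e_r_smul (h : LoopRelations l e x r t) (u : N) :
    e • r • u = r • u := by
  rw [← mul_smul, h.e_r]

theorem r_e_smul (h : LoopRelations l e x r t) (u : N) :
    r • e • u = 0 := by
  rw [← mul_smul, h.r_e, zero_smul]

theorem t_e_smul (h : LoopRelations l e x r t) (u : N) :
    t • e • u = t • u := by
  rw [← mul_smul, h.t_e]

theorem e_t_smul (h : LoopRelations l e x r t) (u : N) :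
    e • t • u = 0 := by
  rw [← mul_smul, h.e_t, zero_smul]

theorem x_r_smul (h : LoopRelations l e x r t) (u : N) :
    x • r • u = 0 := by
  rw [← mul_smul, h.x_r, zero_smul]

theorem t_x_smul (h : LoopRelations l e x r t) (u : N) :
    t • x • u = 0 := by
  rw [← mul_smul, h.t_x, zero_smul]

theorem r_t_smul (h : LoopRelations l e x r t) (u : N) :
    r • t • u = x ^ l • u := by
  rw [← mul_smul, h.r_t]

theorem e_pow_smul (h : LoopRelations l e x r t) (u : N) (i : ℕ) :
    e • x ^ i • u = x ^ i • e • u := by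
  have : Commute e x := by rw [commute_iff_eq, h.e_x, h.x_e]
  rw [← mul_smul, (this.pow_right i).eq, mul_smul]

theorem pow_succ_e_smul (h : LoopRelations l e x r t) (u : N) (i : ℕ) :
    x ^ (i + 1) • e • u = x ^ (i + 1) • u := by
  rw [pow_succ, mul_smul, mul_smul, h.x_e_smul]

theorem pow_smul_eq_zero (h : LoopRelations l e x r t) (u : N) : x ^ (l + 1) • u = 0 := by
  rw [pow_succ', mul_smul, ← h.r_t_smul, h.x_r_smul]

/-- The uniserial module spanned by `x ^ i • v`, enlarged by finitely many vectors `q`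
annihilated by `e`. -/
theorem isSplitFamily (h : LoopRelations l e x r t) {j : ℕ} (hj : ∀ u : N, x ^ (j + 1) • u = 0)
    {v : N} (hv : e • v = v) {ξ : N →ₗ[k] k} (hξe : ∀ u, ξ (e • u) = ξ u)
    (hξ : ξ (x ^ j • v) ≠ 0) {κ : Type*} [Fintype κ] (q : κ → N) (η : κ → N →ₗ[k] k)
    (hq : ∀ i, e • q i = 0) (hη : ∀ i u, η i (e • u) = 0)
    (hηq : ∀ a : κ → k, (∀ i, η i (∑ j, a j • q j) = 0) → a = 0)
    (htv : t • v = 0 ∨ ∃ i, t • v = q i) (hrq : ∀ i, r • q i = 0 ∨ r • q i = x ^ j • v)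
    (hξr : ∀ u, (∀ i, η i u = 0) → ξ (r • u) = 0)
    (hηt : ∀ u, ξ (x ^ j • u) = 0 → ∀ i, η i (t • u) = 0) :
    IsSplitFamily {e, x, r, t} (Sum.elim (fun i : Fin (j + 1) => x ^ (i : ℕ) • v) q)
      (Sum.elim (fun i : Fin (j + 1) => ξ ∘ₗ Algebra.lsmul k k N (x ^ (i : ℕ))) η) := by
  have hev (i : ℕ) : e • x ^ i • v = x ^ i • v := by rw [h.e_pow_smul, hv]
  have hxq (i) : x • q i = 0 := by rw [← h.x_e_smul, hq, smul_zero]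
  have htq (i) : t • q i = 0 := by rw [← h.t_e_smul, hq, smul_zero]
  have hξx (i : ℕ) (u : N) : ξ (x ^ i • e • u) = ξ (x ^ i • u) := by rw [← h.e_pow_smul, hξe]
  have hj' (i : ℕ) (hi : j < i) (u : N) : x ^ i • u = 0 := by
    obtain ⟨c, rfl⟩ := Nat.exists_eq_add_of_lt hi
    rw [show j + c + 1 = c + (j + 1) by ring, pow_add, mul_smul, hj, smul_zero]
  refine ⟨?_, ?_, ?_⟩
  · simp only [Set.mem_insert_iff, Set.mem_singleton_iff, forall_eq_or_imp, forall_eq]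
    refine ⟨?_, ?_, ?_, ?_⟩ <;> rintro (i | i)
    · exact .inr ⟨.inl i, hev i⟩
    · exact .inl (hq i)
    · simp only [Sum.elim_inl, ← mul_smul, ← pow_succ']
      by_cases hi : (i : ℕ) < j
      · exact .inr ⟨.inl ⟨i + 1, by omega⟩, rfl⟩
      · exact .inl (hj' _ (by omega) v)
    · exact .inl (hxq i)
    · refine .inl ?_
      rw [Sum.elim_inl, ← hev, h.r_e_smul]
    · refine (hrq i).imp id fun hi => ⟨.inl (Fin.last j), by simpa using hi⟩
    · obtain ⟨_ | i, hi⟩ := i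
      · simp only [Sum.elim_inl, pow_zero, one_smul]
        exact htv.imp id fun ⟨i, hi⟩ => ⟨.inr i, hi⟩
      · refine .inl ?_
        rw [Sum.elim_inl, pow_succ', mul_smul, h.t_x_smul]
    · exact .inl (htq i)
  · intro s hs u hu
    have hu₁ (i : ℕ) : ξ (x ^ i • u) = 0 := by
      by_cases hi : i < j + 1
      · exact hu (.inl ⟨i, hi⟩)
      · rw [hj' i (by omega), map_zero]
    have hu₂ (i) : η i u = 0 := hu (.inr i)
    simp only [Set.mem_insert_iff, Set.mem_singleton_iff] at hs
    suffices (∀ i : ℕ, ξ (x ^ i • s • u) = 0) ∧ ∀ i, η i (s • u) = 0 by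
      rintro (i | i)
      · exact this.1 i
      · exact this.2 i
    rcases hs with rfl | rfl | rfl | rfl
    · exact ⟨fun i => by rw [hξx, hu₁], fun i => hη i u⟩
    · refine ⟨fun i => ?_, fun i => by rw [← h.e_x_smul, hη]⟩
      rw [← mul_smul, ← pow_succ, hu₁]
    · refine ⟨?_, fun i => by rw [← h.e_r_smul, hη]⟩
      rintro (_ | i)
      · rw [pow_zero, one_smul, hξr u hu₂]
      · rw [pow_succ, mul_smul, h.x_r_smul, smul_zero, map_zero]
    · exact ⟨fun i => by rw [← hξx, h.e_t_smul, smul_zero, map_zero], hηt u (hu₁ j)⟩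
  · intro a ha
    have hηv (i m) : η i (x ^ m • v) = 0 := by rw [← hev, hη]
    have hξq (m : ℕ) (i) : ξ (x ^ m • q i) = 0 := by rw [← hξx, hq, smul_zero, map_zero]
    have h₁ (m : Fin (j + 1)) := ha (.inl m)
    have h₂ (i) := ha (.inr i)
    simp only [Fintype.sum_sum_type, Sum.elim_inl, Sum.elim_inr, LinearMap.comp_apply,
      Algebra.lsmul_coe, map_add, map_sum, map_smul,
      hξq, hηv, smul_zero, Finset.sum_const_zero, add_zero, zero_add,
      ← mul_smul (_ : A) (_ : A), ← pow_add] at h₁ h₂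
    have ha₂ := hηq (fun i => a (.inr i)) fun i => by simpa using h₂ i
    have ha₁ (i : ℕ) (hi : i < j + 1) : a (.inl ⟨i, hi⟩) = 0 := by
      induction i using Nat.strong_induction_on with
      | _ i ih =>
        have := h₁ ⟨j - i, by omega⟩
        rw [Finset.sum_eq_single ⟨i, hi⟩] at this
        · rw [show j - i + i = j by omega] at this
          exact (smul_eq_zero.mp this).resolve_right hξ
        · rintro ⟨i', hi'⟩ - hne
          have hne : i' ≠ i := fun h => hne (Fin.ext h)
          obtain hlt | hlt := lt_or_gt_of_ne hne
          · rw [ih i' hlt, zero_smul]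
          · rw [hj' _ (by simp only; omega), map_zero, smul_zero]
        · simp
    ext (i | i)
    · exact ha₁ i i.2
    · exact congrFun ha₂ i

end

section

variable {k A N : Type*} [Field k] [Ring A] [Algebra k A] [AddCommGroup N] [Module k N]
  [Module A N] [IsScalarTower k A N] {l : ℕ} {e x r t : A}

theorem exists_functional (h : LoopRelations l e x r t) {v : N} (hv : e • v = v)
    {W : Submodule k N} (hW : v ∉ W) (hWe : ∀ w ∈ W, e • w = w) :
    ∃ ξ : N →ₗ[k] k, (∀ u, ξ (e • u) = ξ u) ∧ ξ v ≠ 0 ∧ ∀ w ∈ W, ξ w = 0 := by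
  obtain ⟨f, hfv, hf⟩ := Submodule.exists_le_ker_of_notMem hW
  refine ⟨f ∘ₗ Algebra.lsmul k k N e, fun u => ?_, ?_, fun w hw => ?_⟩
  · change f (e • e • u) = f (e • u)
    rw [h.e_e_smul]
  · change f (e • v) ≠ 0
    rwa [hv]
  · change f (e • w) = 0
    rw [hWe w hw]
    exact hf hw

theorem exists_functional_comp_t (h : LoopRelations l e x r t) (f : N →ₗ[k] k)
    (hf : ∀ u, t • u = 0 → f u = 0) :
    ∃ η : N →ₗ[k] k, (∀ u, η (e • u) = 0) ∧ ∀ u, η (t • u) = f u := by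
  have hmem : f ∈ (LinearMap.ker (Algebra.lsmul k k N t)).dualAnnihilator := by
    rw [Submodule.mem_dualAnnihilator]
    exact fun u hu => hf u hu
  rw [← LinearMap.range_dualMap_eq_dualAnnihilator_ker] at hmem
  obtain ⟨g, hg⟩ := hmem
  refine ⟨g - g ∘ₗ Algebra.lsmul k k N e, fun u => ?_, fun u => ?_⟩
  · change g (e • u) - g (e • e • u) = 0
    rw [h.e_e_smul, sub_self]
  · change g (t • u) - g (e • t • u) = f u
    rw [h.e_t_smul, map_zero, sub_zero, ← hg]
    rfl

/-- Every nonzero module over an algebra generated by `e, x, r, t` has a split family of bounded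
size. -/
theorem exists_isSplitFamily [Nontrivial N] (h : LoopRelations l e x r t) :
    ∃ (ι : Type) (_ : Fintype ι) (b : ι → N) (Φ : ι → N →ₗ[k] k), Nonempty ι ∧
      Fintype.card ι ≤ l + 3 ∧ IsSplitFamily {e, x, r, t} b Φ := by
  classical
  by_cases hA : ∃ w : N, e • w = 0 ∧ r • w = 0 ∧ ∀ u, t • u ≠ w
  · obtain ⟨w, hew, hrw, hw⟩ := hA
    have hnm : w ∉ LinearMap.range (Algebra.lsmul k k N t) ⊔
        LinearMap.range (Algebra.lsmul k k N e) := by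
      rw [Submodule.mem_sup]
      rintro ⟨_, ⟨a, rfl⟩, _, ⟨b, rfl⟩, hab⟩
      change t • a + e • b = w at hab
      have hb : e • b = 0 := by
        rw [← hab, smul_add, h.e_t_smul, zero_add, h.e_e_smul] at hew
        exact hew
      exact hw a (by rw [← hab, hb, add_zero])
    obtain ⟨η, hηw, hη⟩ := Submodule.exists_le_ker_of_notMem hnm
    have hηt (u : N) : η (t • u) = 0 := hη (Submodule.mem_sup_left ⟨u, rfl⟩)
    have hηe (u : N) : η (e • u) = 0 := hη (Submodule.mem_sup_right ⟨u, rfl⟩)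
    refine ⟨Unit, inferInstance, fun _ => w, fun _ => η, inferInstance, by simp, ?_, ?_, ?_⟩
    · simp only [Set.mem_insert_iff, Set.mem_singleton_iff, forall_eq_or_imp, forall_eq]
      refine ⟨fun _ => .inl hew, fun _ => .inl ?_, fun _ => .inl hrw, fun _ => .inl ?_⟩
      · rw [← h.x_e_smul, hew, smul_zero]
      · rw [← h.t_e_smul, hew, smul_zero]
    · simp only [Set.mem_insert_iff, Set.mem_singleton_iff, forall_eq_or_imp, forall_eq]
      refine ⟨fun u _ _ => hηe u, fun u _ _ => ?_, fun u _ _ => ?_, fun u _ _ => hηt u⟩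
      · rw [← h.e_x_smul, hηe]
      · rw [← h.e_r_smul, hηe]
    · intro a ha
      ext
      simpa [hηw] using ha ()
  push Not at hA
  have hne : ∃ u : N, e • u ≠ 0 := by
    by_contra! hne
    obtain ⟨w, hw⟩ := exists_ne (0 : N)
    obtain ⟨u, rfl⟩ := hA w (hne w) (by rw [← h.e_r_smul, hne])
    exact hw (by rw [← h.t_e_smul, hne, smul_zero])
  have hex : ∃ i, ∀ u : N, x ^ i • e • u = 0 := ⟨l + 1, fun u => h.pow_smul_eq_zero _⟩
  obtain ⟨j, hjl, hj, v₀, hev₀, hv₀⟩ : ∃ j ≤ l, (∀ u : N, x ^ (j + 1) • u = 0) ∧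
      ∃ v : N, e • v = v ∧ x ^ j • v ≠ 0 := by
    obtain ⟨j, hj⟩ : ∃ j, Nat.find hex = j + 1 := by
      refine Nat.exists_eq_succ_of_ne_zero fun h0 => ?_
      obtain ⟨u, hu⟩ := hne
      have := Nat.find_spec hex u
      rw [h0, pow_zero, one_smul] at this
      exact hu this
    refine ⟨j, ?_, fun u => ?_, ?_⟩
    · have := Nat.find_min' hex (m := l + 1) fun u => h.pow_smul_eq_zero _
      omega
    · rw [← h.pow_succ_e_smul, ← hj]
      exact Nat.find_spec hex u
    · have := Nat.find_min hex (m := j) (by omega)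
      push Not at this
      obtain ⟨u, hu⟩ := this
      exact ⟨e • u, h.e_e_smul u, hu⟩
  have hrt (u : N) : r • t • u = 0 ∨ r • t • u = x ^ j • u := by
    rw [h.r_t_smul]
    obtain hlt | rfl := hjl.lt_or_eq
    · obtain ⟨c, rfl⟩ := Nat.exists_eq_add_of_lt hlt
      refine .inl ?_
      rw [show j + c + 1 = c + (j + 1) by ring, pow_add, mul_smul, hj, smul_zero]
    · exact .inr rfl
  have hξrt (ξ : N →ₗ[k] k) (u : N) (hu : ξ (x ^ j • u) = 0) : ξ (r • t • u) = 0 := by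
    obtain hu' | hu' := hrt u <;> rw [hu']
    · exact map_zero ξ
    · exact hu
  have hunit {ξ : k} (hξ : ξ ≠ 0) (a : Unit → k) (ha : a () * ξ = 0) : a = 0 := by
    ext
    exact (mul_eq_zero.mp ha).resolve_right hξ
  have hex_j {v : N} (hv : e • v = v) : e • x ^ j • v = x ^ j • v := by rw [h.e_pow_smul, hv]
  by_cases hR : ∃ v w : N, e • v = v ∧ x ^ j • v ≠ 0 ∧ r • w = x ^ j • v
  · by_cases hRT : ∃ v w : N, e • v = v ∧ x ^ j • v ≠ 0 ∧ r • w = x ^ j • v ∧ t • v = 0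
    · obtain ⟨v, w, hv, hxv, hrw, htv⟩ := hRT
      obtain ⟨ξ, hξe, hξv, -⟩ := h.exists_functional (k := k) (W := ⊥) (hex_j hv) (by simpa)
        (by simp)
      refine ⟨Fin (j + 1) ⊕ Unit, inferInstance, _, _, inferInstance, ?_,
        h.isSplitFamily hj hv hξe hξv (fun _ => w - e • w)
          (fun _ => ξ ∘ₗ Algebra.lsmul k k N r) ?_ ?_ ?_ (.inl htv) ?_ ?_ ?_⟩
      · simp; omega
      · intro
        rw [smul_sub, h.e_e_smul, sub_self]
      · intro _ u
        change ξ (r • e • u) = 0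
        rw [h.r_e_smul, map_zero]
      · intro a ha
        refine hunit hξv a ?_
        have : a () • ξ (r • (w - e • w)) = 0 := by simpa using ha ()
        rwa [smul_sub, h.r_e_smul, sub_zero, hrw] at this
      · intro
        right
        rw [smul_sub, h.r_e_smul, sub_zero, hrw]
      · exact fun u hu => hu ()
      · exact fun u hu _ => hξrt ξ u hu
    · obtain ⟨v, w, hv, hxv, hrw⟩ := hR
      push Not at hRT
      obtain ⟨ξ, hξe, hξv, hξW⟩ := h.exists_functional (k := k) (hex_j hv)
        (W := (LinearMap.ker (Algebra.lsmul k k N t)).map (Algebra.lsmul k k N (x ^ j * e))) (by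
          rintro ⟨u, hu, huv⟩
          change t • u = 0 at hu
          change (x ^ j * e) • u = _ at huv
          rw [mul_smul] at huv
          exact hRT (e • u) w (h.e_e_smul u) (huv ▸ hxv) (huv ▸ hrw) (by rw [h.t_e_smul, hu])) (by
          rintro _ ⟨u, hu, rfl⟩
          change e • (x ^ j * e) • u = (x ^ j * e) • u
          rw [mul_smul, h.e_pow_smul, h.e_e_smul])
      obtain ⟨η, hηe, hηt⟩ := h.exists_functional_comp_t (ξ ∘ₗ Algebra.lsmul k k N (x ^ j))
        fun u hu => by
          change ξ (x ^ j • u) = 0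
          rw [← hξe, h.e_pow_smul]
          exact hξW _ ⟨u, hu, mul_smul _ _ _⟩
      obtain hrtv | hrtv := hrt v
      · refine ⟨Fin (j + 1) ⊕ Fin 2, inferInstance, _, _, inferInstance, ?_,
          h.isSplitFamily hj hv hξe hξv ![t • v, w - e • w]
            ![η, ξ ∘ₗ Algebra.lsmul k k N r] ?_ ?_ ?_ (.inr ⟨0, rfl⟩) ?_ ?_ ?_⟩
        · simp; omega
        · simp [Fin.forall_fin_two, smul_sub, h.e_e_smul, h.e_t_smul]
        · simp [Fin.forall_fin_two, hηe, h.r_e_smul]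
        · intro a ha
          have h₀ : η (a 0 • t • v + a 1 • (w - e • w)) = 0 := by simpa using ha 0
          have h₁ : ξ (r • (a 0 • t • v + a 1 • (w - e • w))) = 0 := by simpa using ha 1
          rw [smul_add, smul_comm r, hrtv, smul_zero, zero_add, smul_comm r, smul_sub, h.r_e_smul,
            sub_zero, hrw, map_smul] at h₁
          have ha₁ : a 1 = 0 := (smul_eq_zero.mp h₁).resolve_right hξv
          rw [ha₁, zero_smul, add_zero, map_smul, hηt] at h₀
          have ha₀ : a 0 = 0 := (smul_eq_zero.mp h₀).resolve_right hξv
          ext i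
          fin_cases i
          · exact ha₀
          · exact ha₁
        · rw [Fin.forall_fin_two]
          refine ⟨.inl hrtv, .inr ?_⟩
          change r • (w - e • w) = _
          rw [smul_sub, h.r_e_smul, sub_zero, hrw]
        · exact fun u hu => hu 1
        · intro u hu
          rw [Fin.forall_fin_two]
          exact ⟨(hηt u).trans hu, hξrt ξ u hu⟩
      · refine ⟨Fin (j + 1) ⊕ Unit, inferInstance, _, _, inferInstance, ?_,
          h.isSplitFamily hj hv hξe hξv (fun _ => t • v)
            (fun _ => ξ ∘ₗ Algebra.lsmul k k N r) ?_ ?_ ?_ (.inr ⟨(), rfl⟩) ?_ ?_ ?_⟩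
        · simp; omega
        · exact fun _ => h.e_t_smul v
        · intro _ u
          change ξ (r • e • u) = 0
          rw [h.r_e_smul, map_zero]
        · intro a ha
          refine hunit hξv a ?_
          have : a () • ξ (r • t • v) = 0 := by simpa using ha ()
          rwa [hrtv] at this
        · exact fun _ => .inr hrtv
        · exact fun u hu => hu ()
        · exact fun u hu _ => hξrt ξ u hu
  push Not at hR
  have hξ {v : N} (hv : e • v = v) (hxv : x ^ j • v ≠ 0) : ∃ ξ : N →ₗ[k] k,
      (∀ u, ξ (e • u) = ξ u) ∧ ξ (x ^ j • v) ≠ 0 ∧ ∀ u, ξ (r • u) = 0 := by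
    obtain ⟨ξ, hξe, hξv, hξ⟩ := h.exists_functional (k := k)
      (W := LinearMap.range (Algebra.lsmul k k N r)) (hex_j hv)
      (by rintro ⟨w, hw⟩; exact hR v w hv hxv hw) (by rintro _ ⟨w, rfl⟩; exact h.e_r_smul w)
    exact ⟨ξ, hξe, hξv, fun u => hξ _ ⟨u, rfl⟩⟩
  by_cases hT : ∃ v : N, e • v = v ∧ x ^ j • v ≠ 0 ∧ t • v = 0
  · obtain ⟨v, hv, hxv, htv⟩ := hT
    obtain ⟨ξ, hξe, hξv, hξr⟩ := hξ hv hxv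
    refine ⟨Fin (j + 1) ⊕ Empty, inferInstance, _, _, inferInstance, ?_,
      h.isSplitFamily hj hv hξe hξv Empty.elim Empty.elim (by simp) (by simp)
      (fun _ _ => Subsingleton.elim _ _) (.inl htv) (by simp) (fun u _ => hξr u) (by simp)⟩
    simp; omega
  · push Not at hT
    obtain ⟨ξ, hξe, hξv, hξr⟩ := hξ hev₀ hv₀
    obtain ⟨η, hηe, hηt⟩ := h.exists_functional_comp_t (ξ ∘ₗ Algebra.lsmul k k N (x ^ j))
      fun u hu => by
        change ξ (x ^ j • u) = 0
        rw [← hξe, h.e_pow_smul]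
        by_contra hne
        exact hT (e • u) (h.e_e_smul u) (fun h0 => hne (by rw [h0, map_zero]))
          (by rw [h.t_e_smul, hu])
    refine ⟨Fin (j + 1) ⊕ Unit, inferInstance, _, _, inferInstance, ?_,
      h.isSplitFamily hj hev₀ hξe hξv (fun _ => t • v₀) (fun _ => η) ?_ ?_ ?_ (.inr ⟨(), rfl⟩)
        (fun _ => hrt v₀) (fun u _ => hξr u) (fun u hu _ => (hηt u).trans hu)⟩
    · simp; omega
    · exact fun _ => h.e_t_smul v₀
    · exact fun _ u => hηe u
    · intro a ha
      refine hunit hξv a ?_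
      have : a () • η (t • v₀) = 0 := by simpa using ha ()
      rwa [hηt] at this

end

/-- An algebra generated by elements satisfying the loop relations has finite representation
type. -/
theorem hasFiniteRepType {k A : Type u} [Field k] [Ring A] [Algebra k A] {l : ℕ} {e x r t : A}
    (h : LoopRelations l e x r t) (hgen : Algebra.adjoin k {e, x, r, t} = ⊤) :
    HasFiniteRepType k A :=
  hasFiniteRepType_of_isSplitFamily (Set.toFinite _) hgen (l + 3) fun M _ _ _ _ _ hM =>
    have := hM.nontrivial
    h.exists_isSplitFamily (N := M)

end LoopRelations

theorem geom_sum_eq_sub_one_pow (k : Type*) [Field k] {p : ℕ} (hp : p.Prime) [CharP k p]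
    {A : Type*} [Ring A] [Algebra k A] (c : A) :
    (c - 1) ^ (p - 1) = ∑ i ∈ Finset.range p, c ^ i := by
  have := Fact.mk hp
  have h : (Polynomial.X - 1 : Polynomial k) ^ (p - 1) =
      ∑ i ∈ Finset.range p, Polynomial.X ^ i := by
    have hne : (Polynomial.X - 1 : Polynomial k) ≠ 0 := by
      simpa using Polynomial.X_sub_C_ne_zero (1 : k)
    refine mul_right_cancel₀ hne ?_
    rw [geom_sum_mul, ← pow_succ, Nat.sub_add_cancel hp.pos, sub_pow_char, one_pow]
  simpa using congrArg (Polynomial.aeval c) h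

namespace CohMackey

variable {k G : Type u} [Field k]

theorem hasFiniteRepType_of_subsingleton [Group G] [Subsingleton G] :
    HasFiniteRepType k (CohMackey k G) := by
  classical
  have hsub : Subsingleton (Σ H : Subgroup G, G ⧸ H) := by
    refine ⟨fun ⟨H, x⟩ ⟨K, y⟩ => ?_⟩
    obtain rfl : H = K := Subsingleton.elim _ _
    induction x using QuotientGroup.induction_on with
    | H x =>
      induction y using QuotientGroup.induction_on with
      | H y => rw [Subsingleton.elim x y]
  have h : LoopRelations 1 (0 : CohMackey k G) 0 0 0 := by constructor <;> simp
  refine h.hasFiniteRepType (Algebra.eq_top_iff.mpr fun a => ?_)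
  let o : Σ H : Subgroup G, G ⧸ H := ⟨⊥, (1 : G)⟩
  have ha : a = algebraMap k _ (toMatrix a o o) := by
    refine toMatrix_injective (Matrix.ext fun x y => ?_)
    rw [Algebra.algebraMap_eq_smul_one, map_smul, toMatrix_one, Subsingleton.elim x o,
      Subsingleton.elim y o]
    simp
  rw [ha]
  exact Subalgebra.algebraMap_mem _ _

section PrimeOrder

variable [CommGroup G]

/-- The fixed point of `G` in the disjoint union of all orbits. -/
def fixedPt : Σ H : Subgroup G, G ⧸ H := cosetPt ⊤ 1

theorem smul_fixedPt (g : G) : g • fixedPt (G := G) = fixedPt := by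
  rw [fixedPt, smul_cosetPt]
  have := QuotientGroup.subsingleton_quotient_top (G := G)
  congr 1
  exact Subsingleton.elim _ _

theorem exists_eq_freePt_or_eq_fixedPt (hG : (Nat.card G).Prime) (x : Σ H : Subgroup G, G ⧸ H) :
    (∃ g, x = freePt g) ∨ x = fixedPt := by
  have := Fact.mk hG
  obtain ⟨H, x⟩ := x
  obtain rfl | rfl := H.eq_bot_or_eq_top_of_prime_card
  · induction x using QuotientGroup.induction_on with
    | H x => exact .inl ⟨x, rfl⟩
  · right
    rw [fixedPt, cosetPt]
    have := QuotientGroup.subsingleton_quotient_top (G := G)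
    congr 1
    exact Subsingleton.elim _ _

theorem freePt_ne_fixedPt (hG : (Nat.card G).Prime) (g : G) : freePt g ≠ fixedPt := by
  have : Finite G := Nat.finite_of_card_ne_zero hG.ne_zero
  have : Nontrivial G := (Finite.one_lt_card_iff_nontrivial).mp hG.one_lt
  exact freePt_ne_cosetPt top_ne_bot _ _

/-- The points of the orbits of a group of prime order. -/
noncomputable def optionEquiv (hG : (Nat.card G).Prime) : Option G ≃ Σ H : Subgroup G, G ⧸ H :=
  Equiv.ofBijective (fun o => o.elim fixedPt freePt) <| by
    constructor
    · rintro (_ | g) (_ | h) hgh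
      · rfl
      · exact absurd hgh.symm (freePt_ne_fixedPt hG h)
      · exact absurd hgh (freePt_ne_fixedPt hG g)
      · exact congrArg some (freePt_injective hgh)
    · intro x
      obtain ⟨g, rfl⟩ | rfl := exists_eq_freePt_or_eq_fixedPt hG x
      · exact ⟨some g, rfl⟩
      · exact ⟨none, rfl⟩

theorem toMatrix_free_free' (a : CohMackey k G) (g h : G) :
    toMatrix a (freePt g) (freePt h) = entry (freePt 1) (freePt (g⁻¹ * h)) a := by
  simpa [entry_apply] using (toMatrix_free_free a 1 (g⁻¹ * h) g)

theorem toMatrix_free_fixed (a : CohMackey k G) (g : G) :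
    toMatrix a (freePt g) fixedPt = entry (freePt 1) fixedPt a := by
  have := toMatrix_smul_smul a g (freePt 1) fixedPt
  rwa [smul_freePt, smul_fixedPt, mul_one] at this

theorem toMatrix_fixed_free (a : CohMackey k G) (g : G) :
    toMatrix a fixedPt (freePt g) = entry fixedPt (freePt 1) a := by
  have := toMatrix_smul_smul a g fixedPt (freePt 1)
  rwa [smul_freePt, smul_fixedPt, mul_one] at this

theorem ext_of_prime (hG : (Nat.card G).Prime) {a b : CohMackey k G}
    (h₁ : ∀ g, entry (freePt 1) (freePt g) a = entry (freePt 1) (freePt g) b)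
    (h₂ : entry (freePt 1) fixedPt a = entry (freePt 1) fixedPt b)
    (h₃ : entry fixedPt (freePt 1) a = entry fixedPt (freePt 1) b)
    (h₄ : entry fixedPt fixedPt a = entry fixedPt fixedPt b) : a = b := by
  refine toMatrix_injective (Matrix.ext fun x y => ?_)
  obtain ⟨g, rfl⟩ | rfl := exists_eq_freePt_or_eq_fixedPt hG x <;>
    obtain ⟨h, rfl⟩ | rfl := exists_eq_freePt_or_eq_fixedPt hG y
  · rw [toMatrix_free_free', toMatrix_free_free', h₁]
  · rw [toMatrix_free_fixed, toMatrix_free_fixed, h₂]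
  · rw [toMatrix_fixed_free, toMatrix_fixed_free, h₃]
  · exact h₄

theorem exists_entries_eq (hG : (Nat.card G).Prime) (φ : G → k) (ρ θ σ : k) :
    ∃ a : CohMackey k G, (∀ g, entry (freePt 1) (freePt g) a = φ g) ∧
      entry (freePt 1) fixedPt a = ρ ∧ entry fixedPt (freePt 1) a = θ ∧
      entry fixedPt fixedPt a = σ := by
  have : Finite G := Nat.finite_of_card_ne_zero hG.ne_zero
  let ε := optionEquiv hG
  let M : Option G → Option G → k := fun x y => x.elim (y.elim σ fun _ => θ)
    fun g => y.elim ρ fun h => φ (g⁻¹ * h)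
  have hfree (g : G) : ε.symm (freePt g) = some g := (Equiv.symm_apply_eq ε).mpr rfl
  have hfixed : ε.symm fixedPt = none := (Equiv.symm_apply_eq ε).mpr rfl
  obtain ⟨a, ha⟩ := exists_toMatrix_eq (k := k) (Matrix.of fun x y => M (ε.symm x) (ε.symm y)) (by
    intro g x y
    obtain ⟨h, rfl⟩ | rfl := exists_eq_freePt_or_eq_fixedPt hG x <;>
      obtain ⟨h', rfl⟩ | rfl := exists_eq_freePt_or_eq_fixedPt hG y <;>
      simp [smul_freePt, smul_fixedPt, hfree, hfixed, M, mul_assoc])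
  refine ⟨a, ?_⟩
  simp only [entry_apply, ha, Matrix.of_apply, hfree, hfixed, M, Option.elim, inv_one, one_mul,
    implies_true, and_self]

theorem toMatrix_mul_of_prime [Fintype G] (hG : (Nat.card G).Prime) (a b : CohMackey k G) (x y) :
    toMatrix (a * b) x y = toMatrix a x fixedPt * toMatrix b fixedPt y +
      ∑ g, toMatrix a x (freePt g) * toMatrix b (freePt g) y := by
  have := Fintype.ofFinite (Σ H : Subgroup G, G ⧸ H)
  rw [toMatrix_mul, Matrix.mul_apply, ← Fintype.sum_equiv (optionEquiv hG) _ _ fun _ => rfl,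
    Fintype.sum_option]
  rfl

theorem entry_free_free_mul [Fintype G] (hG : (Nat.card G).Prime) (a b : CohMackey k G) (g : G) :
    entry (freePt 1) (freePt g) (a * b) =
      entry (freePt 1) fixedPt a * entry fixedPt (freePt 1) b +
      ∑ h, entry (freePt 1) (freePt h) a * entry (freePt 1) (freePt (h⁻¹ * g)) b := by
  rw [entry_apply, toMatrix_mul_of_prime hG]
  simp only [toMatrix_free_free', toMatrix_free_fixed, toMatrix_fixed_free, inv_one, one_mul]

theorem entry_free_fixed_mul [Fintype G] (hG : (Nat.card G).Prime) (a b : CohMackey k G) :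
    entry (freePt 1) fixedPt (a * b) =
      entry (freePt 1) fixedPt a * entry fixedPt fixedPt b +
      (∑ h, entry (freePt 1) (freePt h) a) * entry (freePt 1) fixedPt b := by
  rw [entry_apply, toMatrix_mul_of_prime hG, Finset.sum_mul]
  simp only [toMatrix_free_fixed]
  rfl

theorem entry_fixed_free_mul [Fintype G] (hG : (Nat.card G).Prime) (a b : CohMackey k G) :
    entry fixedPt (freePt 1) (a * b) =
      entry fixedPt fixedPt a * entry fixedPt (freePt 1) b +
      entry fixedPt (freePt 1) a * ∑ h, entry (freePt 1) (freePt h) b := by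
  rw [entry_apply, toMatrix_mul_of_prime hG, Finset.mul_sum]
  congr 1
  refine Fintype.sum_equiv (Equiv.inv G) _ _ fun g => ?_
  rw [toMatrix_fixed_free, toMatrix_free_free', mul_one, Equiv.inv_apply]

theorem entry_fixed_fixed_mul [Finite G] (hG : (Nat.card G).Prime) (a b : CohMackey k G) :
    entry fixedPt fixedPt (a * b) =
      entry fixedPt fixedPt a * entry fixedPt fixedPt b +
      (Nat.card G : k) * (entry fixedPt (freePt 1) a * entry (freePt 1) fixedPt b) := by
  have := Fintype.ofFinite G
  rw [entry_apply, toMatrix_mul_of_prime hG]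
  simp only [toMatrix_free_fixed, toMatrix_fixed_free, Finset.sum_const, Finset.card_univ,
    ← Nat.card_eq_fintype_card, nsmul_eq_mul]
  rfl

theorem hasFiniteRepType_of_prime (hp : (Nat.card G).Prime) [CharP k (Nat.card G)] :
    HasFiniteRepType k (CohMackey k G) := by
  classical
  have := Fact.mk hp
  have : Finite G := Nat.finite_of_card_ne_zero hp.ne_zero
  have := Fintype.ofFinite G
  choose E hE₁ hE₂ hE₃ hE₄ using fun g : G =>
    exists_entries_eq (k := k) hp (fun h => if h = g then 1 else 0) 0 0 0
  obtain ⟨r, hr₁, hr₂, hr₃, hr₄⟩ := exists_entries_eq (k := k) (G := G) hp 0 1 0 0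
  obtain ⟨t, ht₁, ht₂, ht₃, ht₄⟩ := exists_entries_eq (k := k) (G := G) hp 0 0 1 0
  have hone₁ (g : G) : entry (freePt 1) (freePt g) (1 : CohMackey k G) =
      if g = 1 then 1 else 0 := by
    rw [entry_apply, toMatrix_one, Matrix.one_apply]
    simp only [freePt_injective.eq_iff, eq_comm]
  have hone₂ : entry (freePt 1) fixedPt (1 : CohMackey k G) = 0 := by
    rw [entry_apply, toMatrix_one, Matrix.one_apply_ne (freePt_ne_fixedPt hp _)]
  have hone₃ : entry fixedPt (freePt 1) (1 : CohMackey k G) = 0 := by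
    rw [entry_apply, toMatrix_one, Matrix.one_apply_ne (freePt_ne_fixedPt hp _).symm]
  have hone₄ : entry fixedPt fixedPt (1 : CohMackey k G) = 1 := by
    rw [entry_apply, toMatrix_one, Matrix.one_apply_eq]
  have hEE (g h) : E g * E h = E (g * h) := by
    refine ext_of_prime hp (fun i => ?_) ?_ ?_ ?_
    · simp only [entry_free_free_mul hp, hE₁, hE₂, ite_mul, one_mul, zero_mul, zero_add,
        Finset.sum_ite_eq', Finset.mem_univ, if_true, inv_mul_eq_iff_eq_mul]
    all_goals
      simp [entry_free_fixed_mul hp, entry_fixed_free_mul hp, entry_fixed_fixed_mul hp, hE₂, hE₃,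
        hE₄]
  have hEr (g) : E g * r = r := by
    refine ext_of_prime hp (fun i => ?_) ?_ ?_ ?_ <;>
      simp [entry_free_free_mul hp, entry_free_fixed_mul hp, entry_fixed_free_mul hp,
        entry_fixed_fixed_mul hp, hE₁, hE₂, hE₃, hE₄, hr₁, hr₂, hr₃, hr₄]
  have hrE (g) : r * E g = 0 := by
    refine ext_of_prime hp (fun i => ?_) ?_ ?_ ?_ <;>
      simp [entry_free_free_mul hp, entry_free_fixed_mul hp, entry_fixed_free_mul hp,
        entry_fixed_fixed_mul hp, hE₁, hE₂, hE₃, hE₄, hr₁, hr₂, hr₃, hr₄]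
  have htE (g) : t * E g = t := by
    refine ext_of_prime hp (fun i => ?_) ?_ ?_ ?_ <;>
      simp [entry_free_free_mul hp, entry_free_fixed_mul hp, entry_fixed_free_mul hp,
        entry_fixed_fixed_mul hp, hE₁, hE₂, hE₃, hE₄, ht₁, ht₂, ht₃, ht₄]
  have hEt (g) : E g * t = 0 := by
    refine ext_of_prime hp (fun i => ?_) ?_ ?_ ?_ <;>
      simp [entry_free_free_mul hp, entry_free_fixed_mul hp, entry_fixed_free_mul hp,
        entry_fixed_fixed_mul hp, hE₁, hE₂, hE₃, hE₄, ht₁, ht₂, ht₃, ht₄]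
  have hrt : r * t = ∑ g, E g := by
    refine ext_of_prime hp (fun i => ?_) ?_ ?_ ?_ <;>
      simp [entry_free_free_mul hp, entry_free_fixed_mul hp, entry_fixed_free_mul hp,
        entry_fixed_fixed_mul hp, hE₁, hE₂, hE₃, hE₄, ht₁, ht₂, ht₃, ht₄, hr₁, hr₂, hr₃, hr₄]
  obtain ⟨γ, hγ⟩ := (isCyclic_of_prime_card (p := Nat.card G) rfl : IsCyclic G).exists_generator
  let c : CohMackey k G := E γ + (1 - E 1)
  have hc (i : ℕ) : c ^ i = E (γ ^ i) + (1 - E 1) := by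
    induction i with
    | zero => simp
    | succ i ih =>
      rw [pow_succ, ih, pow_succ γ]
      simp only [c, mul_add, add_mul, mul_sub, sub_mul, hEE, mul_one, one_mul]
      abel
  have hγ' (g : G) : ∃ i : ℕ, γ ^ i = g := by
    rw [← Submonoid.mem_powers_iff, mem_powers_iff_mem_zpowers]
    exact hγ g
  have hsum : ∑ g, E g = ∑ i ∈ Finset.range (Nat.card G), c ^ i := by
    have himage : Finset.image (fun i => γ ^ i) (Finset.range (Nat.card G)) = Finset.univ :=
      IsCyclic.image_range_card hγ
    have hinj : Set.InjOn (fun i => γ ^ i) (Finset.range (Nat.card G)) := by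
      rw [← Finset.card_image_iff, himage, Finset.card_range, Finset.card_univ,
        Nat.card_eq_fintype_card]
    rw [← himage, Finset.sum_image hinj]
    simp only [hc, Finset.sum_add_distrib, Finset.sum_const, Finset.card_range]
    rw [← Nat.cast_smul_eq_nsmul k, CharP.cast_eq_zero, zero_smul, add_zero]
  have hrel : LoopRelations (Nat.card G - 1) (E 1) (E γ - E 1) r t :=
    { e_e := by rw [hEE, one_mul]
      e_x := by rw [mul_sub, hEE, hEE, one_mul, one_mul]
      x_e := by rw [sub_mul, hEE, hEE, mul_one, mul_one]
      e_r := hEr 1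
      r_e := hrE 1
      t_e := htE 1
      e_t := hEt 1
      x_r := by rw [sub_mul, hEr, hEr, sub_self]
      t_x := by rw [mul_sub, htE, htE, sub_self]
      r_t := by
        rw [hrt, hsum, ← geom_sum_eq_sub_one_pow k hp]
        congr 1
        simp only [c]
        abel }
  refine hrel.hasFiniteRepType (Algebra.eq_top_iff.mpr fun a => ?_)
  set B := Algebra.adjoin k {E 1, E γ - E 1, r, t} with hB
  have he : E 1 ∈ B := Algebra.subset_adjoin (by simp)
  have hx : E γ - E 1 ∈ B := Algebra.subset_adjoin (by simp)
  have hr : r ∈ B := Algebra.subset_adjoin (by simp)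
  have ht : t ∈ B := Algebra.subset_adjoin (by simp)
  have hEmem (g) : E g ∈ B := by
    obtain ⟨i, rfl⟩ := hγ' g
    have hcB : c ∈ B := by
      have := add_mem hx B.one_mem
      rwa [show E γ - E 1 + 1 = c by simp only [c]; abel] at this
    have := sub_mem (pow_mem hcB i) (sub_mem B.one_mem he)
    rwa [hc, add_sub_cancel_right] at this
  have ha : a = ∑ g, entry (freePt 1) (freePt g) a • E g + entry (freePt 1) fixedPt a • r +
      entry fixedPt (freePt 1) a • t + entry fixedPt fixedPt a • (1 - E 1) := by
    refine ext_of_prime hp (fun i => ?_) ?_ ?_ ?_ <;>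
      simp [hE₁, hE₂, hE₃, hE₄, ht₁, ht₂, ht₃, ht₄, hr₁, hr₂, hr₃, hr₄, hone₁, hone₂, hone₃, hone₄]
  rw [ha]
  exact add_mem (add_mem (add_mem (sum_mem fun g _ => B.smul_mem (hEmem g) _) (B.smul_mem hr _))
    (B.smul_mem ht _)) (B.smul_mem (sub_mem B.one_mem he) _)

end PrimeOrder

end CohMackey

/-- Let `k` be a field of characteristic `p > 0` and `m ≥ 0`.  The
cohomological Mackey algebra `μ^{coh}_k(C_{p^m})` of the cyclic group of order `p^m` has
finite representation type if and only if `m ≤ 1`. -/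
theorem cohMackey_hasFiniteRepType_iff (k : Type u) [Field k] (p : ℕ) (hp : p.Prime)
    [CharP k p] (m : ℕ) (G : Type u) [Group G] [Fintype G] (hcyc : IsCyclic G)
    (hcard : Fintype.card G = p ^ m) :
    HasFiniteRepType k (CohMackey k G) ↔ m ≤ 1 := by
  let : CommGroup G := IsCyclic.commGroup
  constructor
  · intro h
    by_contra! hm
    exact CohMackey.not_hasFiniteRepType_of_isCyclic hp hcyc hcard hm h
  · intro hm
    obtain rfl | rfl : m = 0 ∨ m = 1 := by omega
    · have : Subsingleton G := Fintype.card_le_one_iff_subsingleton.mp (by simp [hcard])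
      exact CohMackey.hasFiniteRepType_of_subsingleton
    · have hn : Nat.card G = p := by rw [Nat.card_eq_fintype_card, hcard, pow_one]
      subst hn
      exact CohMackey.hasFiniteRepType_of_prime hp
end

section
/- Let C and D be idempotent complete additive categories and let F : C → D be an additive functor. Suppose that for all objects M, N of C there exist additive maps Δ_{M,N} : Hom_D(FM, FN) → Hom_C(M, N) (not assumed natural) such that: (1) a map f : FM → FN is an isomorphism if and only if Δ_{M,N}(f) : M → N is an isomorphism, and (2) whenever e : FM → FM is idempotent, Δ_{M,M}(e) is idempotent. Then F is essentially injective (FM ≅ FN implies M ≅ N) and F preserves indecomposability (FM is indecomposable whenever M is). -/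
universe u

open CategoryTheory CategoryTheory.Limits TensorProduct

/-- In an idempotent complete preadditive category, the only idempotent endomorphisms of an
indecomposable object are `0` and the identity. -/
theorem IsIndecomposable.idempotent_eq_zero_or_id {C : Type*} [Category C] [Preadditive C]
    [IsIdempotentComplete C] {X : C} (hX : IsIndecomposable X) (p : X ⟶ X) (hp : p ≫ p = p) :
    p = 0 ∨ p = 𝟙 X := by
  obtain ⟨A, i, r, hir, hri⟩ := IsIdempotentComplete.idempotents_split X p hp
  obtain ⟨B, j, s, hjs, hsj⟩ := IsIdempotentComplete.idempotents_split X (𝟙 X - p) (by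
    simp [hp])
  have his : i ≫ s = 0 := by
    have h : i ≫ (s ≫ j) ≫ s = 0 := by
      rw [hsj, ← hri]
      simp [reassoc_of% hir]
    simpa [hjs] using h
  have hjr : j ≫ r = 0 := by
    have h : j ≫ (r ≫ i) ≫ r = 0 := by
      rw [hri, show p = 𝟙 X - s ≫ j by rw [hsj]; abel]
      simp [reassoc_of% hjs]
    simpa [hir] using h
  let c : BinaryBicone A B :=
    { pt := X, fst := r, snd := s, inl := i, inr := j
      inl_fst := hir, inl_snd := his, inr_fst := hjr, inr_snd := hjs }
  have hc : c.fst ≫ c.inl + c.snd ≫ c.inr = 𝟙 c.pt := by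
    change r ≫ i + s ≫ j = 𝟙 X
    rw [hri, hsj]
    abel
  rcases hX.2 A B c ⟨isBinaryBilimitOfTotal c hc⟩ ⟨Iso.refl X⟩ with hA | hB
  · left
    rw [← hri, hA.eq_of_tgt r 0, zero_comp]
  · right
    rw [hB.eq_of_tgt s 0, zero_comp] at hsj
    exact (sub_eq_zero.mp hsj.symm).symm

/-- A nonzero object all of whose idempotent endomorphisms are `0` or the identity is
indecomposable. -/
theorem isIndecomposable_of_idempotent_eq_zero_or_id {C : Type*} [Category C]
    [HasZeroMorphisms C] {X : C} (hX : ¬ IsZero X)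
    (h : ∀ e : X ⟶ X, e ≫ e = e → e = 0 ∨ e = 𝟙 X) : IsIndecomposable X := by
  refine ⟨hX, ?_⟩
  rintro A B c - ⟨φ⟩
  rcases h (φ.hom ≫ c.fst ≫ c.inl ≫ φ.inv) (by simp) with he | he
  · left
    rw [IsZero.iff_id_eq_zero]
    calc 𝟙 A = c.inl ≫ φ.inv ≫ (φ.hom ≫ c.fst ≫ c.inl ≫ φ.inv) ≫ φ.hom ≫ c.fst := by simp
      _ = 0 := by rw [he]; simp
  · right
    rw [IsZero.iff_id_eq_zero]
    calc 𝟙 B = c.inr ≫ φ.inv ≫ 𝟙 X ≫ φ.hom ≫ c.snd := by simp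
      _ = 0 := by rw [← he]; simp

/-- An idempotent isomorphism is the identity. -/
theorem eq_id_of_idempotent_of_isIso {C : Type*} [Category C] {X : C} (e : X ⟶ X)
    (he : e ≫ e = e) [IsIso e] : e = 𝟙 X := by
  rw [← cancel_epi e, he, Category.comp_id]

/-- Let `C` and `D` be idempotent complete additive categories and let
`F : C ⥤ D` be an additive functor.  Suppose there are additive maps
`Δ M N : (F.obj M ⟶ F.obj N) → (M ⟶ N)` such that a map `f : F.obj M ⟶ F.obj N` is an
isomorphism iff `Δ M N f` is, and `Δ M M e` is idempotent whenever `e` is.  Then `F` is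
essentially injective and preserves indecomposability. -/
theorem essInj_and_indec_of_retraction {C D : Type*} [Category C] [Category D]
    [Preadditive C] [Preadditive D] [HasFiniteBiproducts C] [HasFiniteBiproducts D]
    [IsIdempotentComplete C] [IsIdempotentComplete D] (F : C ⥤ D) [F.Additive]
    (Δ : ∀ M N : C, (F.obj M ⟶ F.obj N) → (M ⟶ N))
    (hadd : ∀ (M N : C) (f g : F.obj M ⟶ F.obj N), Δ M N (f + g) = Δ M N f + Δ M N g)
    (hiso : ∀ (M N : C) (f : F.obj M ⟶ F.obj N), IsIso f ↔ IsIso (Δ M N f))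
    (hidem : ∀ (M : C) (e : F.obj M ⟶ F.obj M), e ≫ e = e → Δ M M e ≫ Δ M M e = Δ M M e) :
    (∀ M N : C, Nonempty (F.obj M ≅ F.obj N) → Nonempty (M ≅ N)) ∧
    (∀ M : C, IsIndecomposable M → IsIndecomposable (F.obj M)) := by
  have hzero (M N : C) : Δ M N 0 = 0 := by simpa using hadd M N 0 0
  have hid (M : C) : Δ M M (𝟙 _) = 𝟙 M :=
    have := (hiso M M (𝟙 _)).mp inferInstance
    eq_id_of_idempotent_of_isIso _ (hidem M _ (Category.comp_id _))
  have eq_id {M : C} {e : F.obj M ⟶ F.obj M} (he : e ≫ e = e) (h : Δ M M e = 𝟙 M) :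
      e = 𝟙 _ :=
    have := (hiso M M e).mpr (h ▸ inferInstance)
    eq_id_of_idempotent_of_isIso e he
  refine ⟨fun M N ⟨φ⟩ => ?_, fun M hM => ?_⟩
  · have := (hiso M N φ.hom).mp inferInstance
    exact ⟨asIso (Δ M N φ.hom)⟩
  refine isIndecomposable_of_idempotent_eq_zero_or_id (fun h => hM.1 ?_) fun e he => ?_
  · rw [IsZero.iff_id_eq_zero, ← hid, h.eq_of_src (𝟙 _) 0, hzero]
  rcases hM.idempotent_eq_zero_or_id _ (hidem M e he) with h | h
  · left
    have hsum := hadd M M e (𝟙 _ - e)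
    rw [add_sub_cancel, hid, h, zero_add] at hsum
    simpa using eq_id (e := 𝟙 _ - e) (by simp [he]) hsum.symm
  · exact Or.inr (eq_id he h)
end
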